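/- arXiv:1710.03706 — 3 statements merged into one kernel-verified Lean document; each statement's English description precedes it below -/
import Mathlib

section
/- For all sufficiently small ε > 0, the operator L_ε = (1−ε) L_G + ε L_R has a unique fixed probability density h_ε, which belongs to C²([0,1]); the operator I − L_G is boundedly invertible on the space of C¹ functions on [0,1] with zero Lebesgue mean; the function L_R h_G − h_G has zero Lebesgue mean; and the first-order expansion ‖h_ε − h_G − ε (I − L_G)^{-1}(L_R h_G − h_G)‖_{C¹} = o(ε) holds as ε → 0⁺. -/
/-- Transfer operator of the Gauss map. -/
noncomputable def LG (f : ℝ → ℝ) (x : ℝ) : ℝ :=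
  ∑' n : ℕ, f (1 / ((n:ℝ) + 1 + x)) / ((n:ℝ) + 1 + x) ^ 2

/-- Transfer operator of the Rényi map. -/
noncomputable def LR (f : ℝ → ℝ) (x : ℝ) : ℝ :=
  ∑' n : ℕ, f (1 - 1 / ((n:ℝ) + 1 + x)) / ((n:ℝ) + 1 + x) ^ 2

/-- The invariant density of the Gauss map. -/
noncomputable def hG (x : ℝ) : ℝ := (1 / Real.log 2) * (1 / (1 + x))

/-- The C¹ norm on [0,1]. -/
noncomputable def C1n (f : ℝ → ℝ) : ℝ :=
  (⨆ x : Set.Icc (0:ℝ) 1, |f x|) +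
    ⨆ x : Set.Icc (0:ℝ) 1, |derivWithin f (Set.Icc 0 1) x|


namespace GR

/-- The unit interval. -/
abbrev I : Set ℝ := Set.Icc (0:ℝ) 1

/-- One-sided derivative on the unit interval. -/
noncomputable abbrev dI (f : ℝ → ℝ) : ℝ → ℝ := derivWithin f I

lemma udI : UniqueDiffOn ℝ I := uniqueDiffOn_Icc (by norm_num)

/-- comparison sequence -/
noncomputable def zs (n : ℕ) : ℝ := 1 / ((n:ℝ) + 1) ^ 2

/-- its sum -/
noncomputable def Z : ℝ := ∑' n, zs n

lemma zs_nonneg (n : ℕ) : 0 ≤ zs n := by unfold zs; positivity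

lemma zs_summable : Summable zs := by
  have h := (summable_nat_add_iff 1).2 (Real.summable_one_div_nat_pow (p := 2).2 (by norm_num))
  refine h.congr ?_
  intro n; simp [zs]

lemma Z_nonneg : 0 ≤ Z := tsum_nonneg zs_nonneg

lemma deriv_tsum {f f' : ℕ → ℝ → ℝ} {u : ℕ → ℝ} (hu : Summable u)
    (hf : ∀ n, ∀ x ∈ I, HasDerivWithinAt (f n) (f' n x) I x)
    (hc : ∀ n, ContinuousOn (f' n) I) (hb : ∀ n, ∀ x ∈ I, |f' n x| ≤ u n)
    (hs : ∀ x ∈ I, Summable (fun n => f n x)) :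
    ∀ x ∈ I, HasDerivWithinAt (fun y => ∑' n, f n y) (∑' n, f' n x) I x := by
  have h01 : (0:ℝ) ≤ 1 := by norm_num
  set g : ℕ → ℝ → ℝ := fun n => Set.IccExtend h01 (Set.domRestrict (Set.Icc (0:ℝ) 1) (f' n)) with hg
  have gc : ∀ n, Continuous (g n) := fun n =>
    (continuousOn_iff_continuous_domRestrict.1 (hc n)).Icc_extend'
  have gI : ∀ n, ∀ x ∈ I, g n x = f' n x := by
    intro n x hx
    simp only [hg]
    rw [Set.IccExtend_of_mem h01 _ hx]; rfl
  have gb : ∀ n x, ‖g n x‖ ≤ u n := by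
    intro n x
    simp only [hg, Set.IccExtend, Function.comp, Set.domRestrict, Real.norm_eq_abs]
    exact hb n _ (Subtype.mem _)
  set F : ℕ → ℝ → ℝ := fun n x => f n 0 + ∫ t in (0:ℝ)..x, g n t with hF
  have Fd : ∀ n x, HasDerivAt (F n) (g n x) x := by
    intro n x
    exact (intervalIntegral.integral_hasDerivAt_right ((gc n).intervalIntegrable _ _)
      ((gc n).stronglyMeasurableAtFilter _ _) (gc n).continuousAt).const_add _
  have FI : ∀ n, ∀ x ∈ I, F n x = f n x := by
    intro n x hx
    have : ∫ t in (0:ℝ)..x, g n t = f n x - f n 0 := by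
      refine intervalIntegral.integral_eq_sub_of_hasDerivAt_of_le hx.1 ?_ ?_
        ((gc n).intervalIntegrable _ _)
      · intro y hy
        exact ((hf n y ⟨hy.1, hy.2.trans hx.2⟩).continuousWithinAt).mono
          (Set.Icc_subset_Icc le_rfl hx.2)
      · intro y hy
        have hyI : y ∈ I := ⟨hy.1.le, hy.2.le.trans hx.2⟩
        rw [gI n y hyI]
        exact (hf n y hyI).hasDerivAt (Icc_mem_nhds hy.1 (hy.2.trans_le hx.2))
    simp only [hF, this]; ring
  have h0 : (0:ℝ) ∈ I := ⟨le_rfl, h01⟩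
  have key := fun x => hasDerivAt_tsum hu Fd gb (y₀ := 0) ((hs 0 h0).congr fun n => (FI n 0 h0).symm) x
  intro x hx
  have e : ∑' n, g n x = ∑' n, f' n x := tsum_congr fun n => gI n x hx
  rw [← e]
  refine (key x).hasDerivWithinAt.congr ?_ ?_
  · intro y hy; exact tsum_congr fun n => (FI n y hy).symm
  · exact tsum_congr fun n => (FI n x hx).symm

/-- The weighted composition operators. -/
noncomputable def S (c σ : ℝ) (k : ℕ) (f : ℝ → ℝ) (x : ℝ) : ℝ :=
  ∑' n : ℕ, f (c + σ / ((n:ℝ) + 1 + x)) / ((n:ℝ) + 1 + x) ^ k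

/-- Admissible branches. -/
structure Br (c σ : ℝ) : Prop where
  s : |σ| = 1
  m : ∀ y : ℝ, 1 ≤ y → c + σ / y ∈ I

lemma brG : Br 0 1 := by
  refine ⟨by simp, fun y hy => ⟨by positivity, ?_⟩⟩
  rw [zero_add, div_le_one (by linarith)]; exact hy

lemma brR : Br 1 (-1) := by
  refine ⟨by simp, fun y hy => ?_⟩
  have h1 : 1 / y ≤ 1 := by rw [div_le_one (by linarith)]; exact hy
  have h2 : 0 ≤ 1 / y := by positivity
  constructor
  · have : 1 + -1 / y = 1 - 1 / y := by ring
    rw [this]; linarith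
  · have : 1 + -1 / y = 1 - 1 / y := by ring
    rw [this]; linarith

lemma LG_eq : LG = S 0 1 2 := by
  funext f x; simp [LG, S]

lemma LR_eq : LR = S 1 (-1) 2 := by
  funext f x
  simp only [LR, S]
  refine tsum_congr fun n => ?_
  rw [show 1 - 1 / ((n:ℝ) + 1 + x) = 1 + -1 / ((n:ℝ) + 1 + x) by ring]

lemma one_le_m {x : ℝ} (hx : x ∈ I) (n : ℕ) : 1 ≤ (n:ℝ) + 1 + x := by
  have : (0:ℝ) ≤ n := n.cast_nonneg
  linarith [hx.1]

lemma inv_le_zs {x : ℝ} (hx : x ∈ I) (n k : ℕ) (hk : 2 ≤ k) :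
    1 / ((n:ℝ) + 1 + x) ^ k ≤ zs n := by
  unfold zs
  have h1 := one_le_m hx n
  have hn : (0:ℝ) ≤ n := n.cast_nonneg
  apply one_div_le_one_div_of_le (by positivity)
  calc ((n:ℝ) + 1) ^ 2 ≤ ((n:ℝ) + 1 + x) ^ 2 := by
        apply pow_le_pow_left₀ (by positivity); linarith [hx.1]
    _ ≤ _ := pow_le_pow_right₀ h1 hk

section
variable {c σ : ℝ}

lemma term_bound (hb : Br c σ) {k : ℕ} (hk : 2 ≤ k) {f : ℝ → ℝ} {m : ℝ}
    (hf : ∀ x ∈ I, |f x| ≤ m) {x : ℝ} (hx : x ∈ I) (n : ℕ) :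
    |f (c + σ / ((n:ℝ) + 1 + x)) / ((n:ℝ) + 1 + x) ^ k| ≤ m * zs n := by
  have h1 := one_le_m hx n
  have h2 := hf _ (hb.m _ h1)
  have hm : 0 ≤ m := (abs_nonneg _).trans h2
  rw [abs_div, abs_of_pos (a := ((n:ℝ) + 1 + x) ^ k) (by positivity), div_eq_mul_one_div]
  exact mul_le_mul h2 (inv_le_zs hx n k hk) (by positivity) hm

lemma S_summable (hb : Br c σ) {k : ℕ} (hk : 2 ≤ k) {f : ℝ → ℝ} {m : ℝ}
    (hf : ∀ x ∈ I, |f x| ≤ m) {x : ℝ} (hx : x ∈ I) :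
    Summable fun n : ℕ => f (c + σ / ((n:ℝ) + 1 + x)) / ((n:ℝ) + 1 + x) ^ k :=
  Summable.of_norm_bounded (zs_summable.mul_left m) (fun n => term_bound hb hk hf hx n)

lemma S_bound (hb : Br c σ) {k : ℕ} (hk : 2 ≤ k) {f : ℝ → ℝ} {m : ℝ}
    (hf : ∀ x ∈ I, |f x| ≤ m) {x : ℝ} (hx : x ∈ I) : |S c σ k f x| ≤ m * Z := by
  have := tsum_of_norm_bounded (zs_summable.hasSum.mul_left m)
    (fun n => (Real.norm_eq_abs _).le.trans (term_bound hb hk hf hx n))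
  exact this

lemma bdd_of_cont {f : ℝ → ℝ} (hf : ContinuousOn f I) : ∃ m, ∀ x ∈ I, |f x| ≤ m := by
  obtain ⟨m, hm⟩ := isCompact_Icc.exists_bound_of_continuousOn hf
  exact ⟨m, hm⟩

lemma phi_cont (n : ℕ) : ContinuousOn (fun x : ℝ => c + σ / ((n:ℝ) + 1 + x)) I := by
  refine continuousOn_const.add (continuousOn_const.div (by fun_prop) ?_)
  intro x hx; linarith [one_le_m hx n]

lemma term_cont (hb : Br c σ) {k : ℕ} {f : ℝ → ℝ} (hf : ContinuousOn f I) (n : ℕ) :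
    ContinuousOn (fun x => f (c + σ / ((n:ℝ) + 1 + x)) / ((n:ℝ) + 1 + x) ^ k) I := by
  refine ContinuousOn.div (hf.comp (phi_cont n) ?_) (by fun_prop) ?_
  · intro x hx; exact hb.m _ (one_le_m hx n)
  · intro x hx; have := one_le_m hx n; positivity

lemma S_cont (hb : Br c σ) {k : ℕ} (hk : 2 ≤ k) {f : ℝ → ℝ} (hf : ContinuousOn f I) :
    ContinuousOn (S c σ k f) I := by
  obtain ⟨m, hm⟩ := bdd_of_cont hf
  exact continuousOn_tsum (fun n => term_cont hb hf n) (zs_summable.mul_left m)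
    (fun n x hx => term_bound hb hk hm hx n)

lemma S_deriv (hb : Br c σ) {k : ℕ} (hk : 2 ≤ k) {f f' : ℝ → ℝ}
    (hf : ∀ x ∈ I, HasDerivWithinAt f (f' x) I x) (hc : ContinuousOn f' I) :
    ∀ x ∈ I, HasDerivWithinAt (S c σ k f)
      (-σ * S c σ (k+2) f' x - k * S c σ (k+1) f x) I x := by
  have hfc : ContinuousOn f I := fun x hx => (hf x hx).continuousWithinAt
  obtain ⟨m, hm⟩ := bdd_of_cont hfc
  obtain ⟨m', hm'⟩ := bdd_of_cont hc
  have key := deriv_tsum (f := fun n x => f (c + σ / ((n:ℝ) + 1 + x)) / ((n:ℝ) + 1 + x) ^ k)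
    (f' := fun n x => -σ * (f' (c + σ / ((n:ℝ) + 1 + x)) / ((n:ℝ) + 1 + x) ^ (k+2))
      - k * (f (c + σ / ((n:ℝ) + 1 + x)) / ((n:ℝ) + 1 + x) ^ (k+1)))
    (u := fun n => m' * zs n + k * (m * zs n))
    ((zs_summable.mul_left m').add ((zs_summable.mul_left m).mul_left (k:ℝ))) ?_ ?_ ?_ ?_
  · intro x hx
    have := key x hx
    rw [Summable.tsum_sub ((S_summable hb (by omega) hm' hx).mul_left _)
      ((S_summable hb (by omega) hm hx).mul_left _), tsum_mul_left, tsum_mul_left] at this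
    exact this
  · intro n x hx
    have h1 := one_le_m hx n
    have hne : (n:ℝ) + 1 + x ≠ 0 := by linarith
    have hd : HasDerivWithinAt (fun x : ℝ => (n:ℝ) + 1 + x) 1 I x :=
      (hasDerivWithinAt_id x I).const_add _
    have hφ : HasDerivWithinAt (fun x : ℝ => c + σ / ((n:ℝ) + 1 + x))
        (-σ / ((n:ℝ) + 1 + x) ^ 2) I x := by
      have := ((hasDerivWithinAt_const x I σ).div hd hne).const_add c
      refine HasDerivWithinAt.congr_deriv this ?_
      ring
    have hcomp := (hf _ (hb.m _ h1)).comp x hφ (fun y hy => hb.m _ (one_le_m hy n))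
    have := hcomp.div (hd.pow k) (pow_ne_zero k hne)
    refine HasDerivWithinAt.congr_deriv this ?_
    obtain ⟨j, rfl⟩ : ∃ j, k = j + 1 := ⟨k - 1, by omega⟩
    simp only [Function.comp, Nat.add_sub_cancel, Pi.pow_apply]
    push_cast
    field_simp
    ring
  · intro n
    exact (continuousOn_const.mul (term_cont hb hc n)).sub
      (continuousOn_const.mul (term_cont hb hfc n))
  · intro n x hx
    have a1 := term_bound hb (k := k+2) (by omega) hm' hx n
    have a2 := term_bound hb (k := k+1) (by omega) hm hx n
    refine (abs_sub _ _).trans ?_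
    rw [abs_mul, abs_mul, abs_neg, hb.s, one_mul, Nat.abs_cast]
    gcongr
  · intro x hx
    exact S_summable hb hk hm hx

lemma S_sub (hb : Br c σ) {k : ℕ} (hk : 2 ≤ k) {f g : ℝ → ℝ} (hf : ContinuousOn f I)
    (hg : ContinuousOn g I) {x : ℝ} (hx : x ∈ I) (a b : ℝ) :
    S c σ k (fun t => a * f t + b * g t) x = a * S c σ k f x + b * S c σ k g x := by
  obtain ⟨m, hm⟩ := bdd_of_cont hf
  obtain ⟨m', hm'⟩ := bdd_of_cont hg
  unfold S
  rw [← tsum_mul_left, ← tsum_mul_left, ← Summable.tsum_add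
    ((S_summable hb hk hm hx).mul_left _) ((S_summable hb hk hm' hx).mul_left _)]
  refine tsum_congr fun n => ?_
  ring

lemma S_congr (hb : Br c σ) {k : ℕ} {f g : ℝ → ℝ} (hfg : Set.EqOn f g I) {x : ℝ} (hx : x ∈ I) :
    S c σ k f x = S c σ k g x := by
  unfold S
  refine tsum_congr fun n => ?_
  rw [hfg (hb.m _ (one_le_m hx n))]

end

open Filter Topology
lemma tele {a : ℕ → ℝ} {l : ℝ} (hs : Summable (fun n => a n - a (n+1)))
    (ht : Tendsto a atTop (𝓝 l)) : ∑' n, (a n - a (n+1)) = a 0 - l := by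
  have h1 := hs.hasSum.tendsto_sum_nat
  have h2 : Tendsto (fun N => ∑ n ∈ Finset.range N, (a n - a (n+1))) atTop (𝓝 (a 0 - l)) := by
    simp_rw [Finset.sum_range_sub']
    exact ht.const_sub _
  exact tendsto_nhds_unique h1 h2

lemma tendsto_inv_m (x : ℝ) : Tendsto (fun n : ℕ => 1 / ((n:ℝ) + 1 + x)) atTop (𝓝 0) := by
  have : Tendsto (fun n : ℕ => (n:ℝ) + 1 + x) atTop atTop :=
    (tendsto_natCast_atTop_atTop.atTop_add tendsto_const_nhds).atTop_add tendsto_const_nhds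
  simp only [one_div]
  exact this.inv_tendsto_atTop

lemma intble {f : ℝ → ℝ} (hf : ContinuousOn f I) :
    IntervalIntegrable f MeasureTheory.volume 0 1 := by
  apply ContinuousOn.intervalIntegrable
  rwa [Set.uIcc_of_le (by norm_num)]

/-- Existence of a primitive. -/
lemma prim {f : ℝ → ℝ} (hf : ContinuousOn f I) : ∃ F : ℝ → ℝ,
    (∀ x ∈ I, HasDerivWithinAt F (f x) I x) ∧ ∫ x in (0:ℝ)..1, f x = F 1 - F 0 := by
  have h01 : (0:ℝ) ≤ 1 := by norm_num
  set g := Set.IccExtend h01 (Set.domRestrict (Set.Icc (0:ℝ) 1) f) with hg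
  have gc : Continuous g := (continuousOn_iff_continuous_domRestrict.1 hf).Icc_extend'
  have gI : ∀ x ∈ I, g x = f x := by
    intro x hx
    rw [hg, Set.IccExtend_of_mem h01 _ hx]; rfl
  have hd : ∀ x ∈ I, HasDerivWithinAt (fun x => ∫ t in (0:ℝ)..x, g t) (f x) I x := by
    intro x hx
    rw [← gI x hx]
    exact (intervalIntegral.integral_hasDerivAt_right (gc.intervalIntegrable _ _)
      (gc.stronglyMeasurableAtFilter _ _) gc.continuousAt).hasDerivWithinAt
  refine ⟨_, hd, ?_⟩
  simp only [intervalIntegral.integral_same, sub_zero]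
  apply intervalIntegral.integral_congr
  intro x hx
  rw [Set.uIcc_of_le h01] at hx
  exact (gI x hx).symm

lemma int_tsum {f : ℕ → ℝ → ℝ} {u : ℕ → ℝ} (hu : Summable u) (hc : ∀ n, ContinuousOn (f n) I)
    (hb : ∀ n, ∀ x ∈ I, |f n x| ≤ u n) :
    HasSum (fun n => ∫ x in (0:ℝ)..1, f n x) (∫ x in (0:ℝ)..1, ∑' n, f n x) := by
  refine intervalIntegral.hasSum_integral_of_dominated_convergence (fun n _ => u n) ?_ ?_ ?_ ?_ ?_
  · intro n
    exact (intble (hc n)).def'.aestronglyMeasurable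
  · intro n
    refine Filter.Eventually.of_forall fun x hx => ?_
    rw [Set.uIoc_of_le (by norm_num)] at hx
    exact hb n x ⟨hx.1.le, hx.2⟩
  · exact Filter.Eventually.of_forall fun x hx => hu
  · exact intervalIntegrable_const
  · refine Filter.Eventually.of_forall fun x hx => ?_
    rw [Set.uIoc_of_le (by norm_num)] at hx
    exact (Summable.of_norm_bounded hu (fun n => hb n x ⟨hx.1.le, hx.2⟩)).hasSum

lemma int_S {c σ : ℝ} (hb : Br c σ) {f F : ℝ → ℝ} (hf : ContinuousOn f I)
    (hF : ∀ x ∈ I, HasDerivWithinAt F (f x) I x) (hc0 : c ∈ I) :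
    ∫ x in (0:ℝ)..1, S c σ 2 f x = σ * F (c + σ) - σ * F c := by
  have hσ : σ * σ = 1 := by
    have := hb.s
    rw [← abs_mul_abs_self, this]; norm_num
  obtain ⟨m, hm⟩ := bdd_of_cont hf
  have h := int_tsum (zs_summable.mul_left m) (fun n => term_cont hb (k := 2) hf n)
    (fun n x hx => term_bound hb le_rfl hm hx n)
  have hFc : ContinuousOn F I := fun x hx => (hF x hx).continuousWithinAt
  set a : ℕ → ℝ := fun n => σ * F (c + σ / ((n:ℝ) + 1)) with ha
  have hn : ∀ n : ℕ, ∫ x in (0:ℝ)..1, f (c + σ / ((n:ℝ) + 1 + x)) / ((n:ℝ) + 1 + x) ^ 2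
      = a n - a (n+1) := by
    intro n
    have hd : ∀ x ∈ I, HasDerivWithinAt (fun x => -σ * F (c + σ / ((n:ℝ) + 1 + x)))
        (f (c + σ / ((n:ℝ) + 1 + x)) / ((n:ℝ) + 1 + x) ^ 2) I x := by
      intro x hx
      have h1 := one_le_m hx n
      have hne : (n:ℝ) + 1 + x ≠ 0 := by linarith
      have hd : HasDerivWithinAt (fun x : ℝ => (n:ℝ) + 1 + x) 1 I x :=
        (hasDerivWithinAt_id x I).const_add _
      have hφ : HasDerivWithinAt (fun x : ℝ => c + σ / ((n:ℝ) + 1 + x))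
          (-σ / ((n:ℝ) + 1 + x) ^ 2) I x := by
        have := ((hasDerivWithinAt_const x I σ).div hd hne).const_add c
        refine HasDerivWithinAt.congr_deriv this ?_
        ring
      have hcomp := ((hF _ (hb.m _ h1)).comp x hφ
        (fun y hy => hb.m _ (one_le_m hy n))).const_mul (-σ)
      refine HasDerivWithinAt.congr_deriv hcomp ?_
      calc _ = (σ * σ) * (f (c + σ / ((n:ℝ) + 1 + x)) / ((n:ℝ) + 1 + x) ^ 2) := by ring
        _ = _ := by rw [hσ, one_mul]
    rw [intervalIntegral.integral_eq_sub_of_hasDerivAt_of_le (by norm_num)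
      (fun x hx => (hd x hx).continuousWithinAt)
      (fun x hx => (hd x ⟨hx.1.le, hx.2.le⟩).hasDerivAt (Icc_mem_nhds hx.1 hx.2))
      (intble (term_cont hb hf n))]
    simp only [ha]
    push_cast
    rw [add_zero]; ring
  simp_rw [hn] at h
  have hlim : Tendsto a atTop (𝓝 (σ * F c)) := by
    refine Tendsto.const_mul σ ?_
    have h1 : Tendsto (fun n : ℕ => c + σ / ((n:ℝ) + 1)) atTop (𝓝[I] c) := by
      refine tendsto_nhdsWithin_iff.2 ⟨?_, Filter.Eventually.of_forall fun n => hb.m _ ?_⟩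
      · have := ((tendsto_inv_m 0).const_mul σ).const_add c
        simpa [div_eq_mul_inv] using this
      · have : (0:ℝ) ≤ n := n.cast_nonneg
        linarith
    exact (hFc c hc0).tendsto.comp h1
  have := tele h.summable hlim
  have h2 := h.tsum_eq
  rw [this] at h2
  simp only [ha, Nat.cast_zero, zero_add, div_one] at h2
  exact h2.symm

lemma int_LG {f : ℝ → ℝ} (hf : ContinuousOn f I) :
    ∫ x in (0:ℝ)..1, LG f x = ∫ x in (0:ℝ)..1, f x := by
  obtain ⟨F, hF, hi⟩ := prim hf
  rw [LG_eq, int_S brG hf hF ⟨le_rfl, by norm_num⟩, hi]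
  norm_num

lemma int_LR {f : ℝ → ℝ} (hf : ContinuousOn f I) :
    ∫ x in (0:ℝ)..1, LR f x = ∫ x in (0:ℝ)..1, f x := by
  obtain ⟨F, hF, hi⟩ := prim hf
  rw [LR_eq, int_S brR hf hF ⟨by norm_num, le_rfl⟩, hi]
  norm_num
  ring

/-- the annealed operator -/
noncomputable def Le (ε : ℝ) (f : ℝ → ℝ) (x : ℝ) : ℝ := (1 - ε) * LG f x + ε * LR f x

lemma LG_cont {f : ℝ → ℝ} (hf : ContinuousOn f I) : ContinuousOn (LG f) I := by
  rw [LG_eq]; exact S_cont brG le_rfl hf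

lemma LR_cont {f : ℝ → ℝ} (hf : ContinuousOn f I) : ContinuousOn (LR f) I := by
  rw [LR_eq]; exact S_cont brR le_rfl hf

lemma Le_cont (ε : ℝ) {f : ℝ → ℝ} (hf : ContinuousOn f I) : ContinuousOn (Le ε f) I :=
  (continuousOn_const.mul (LG_cont hf)).add (continuousOn_const.mul (LR_cont hf))

lemma int_Le (ε : ℝ) {f : ℝ → ℝ} (hf : ContinuousOn f I) :
    ∫ x in (0:ℝ)..1, Le ε f x = ∫ x in (0:ℝ)..1, f x := by
  unfold Le
  rw [intervalIntegral.integral_add ((intble (LG_cont hf)).const_mul _)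
    ((intble (LR_cont hf)).const_mul _), intervalIntegral.integral_const_mul,
    intervalIntegral.integral_const_mul, int_LG hf, int_LR hf]
  ring

open Filter Topology

lemma C1_iff {f : ℝ → ℝ} : ContDiffOn ℝ 1 f I ↔
    (∀ x ∈ I, HasDerivWithinAt f (dI f x) I x) ∧ ContinuousOn (dI f) I := by
  rw [contDiffOn_one_iff_derivWithin udI]
  refine and_congr_left fun _ => ⟨fun h x hx => (h x hx).hasDerivWithinAt,
    fun h x hx => (h x hx).differentiableWithinAt⟩

lemma C1_of {f f' : ℝ → ℝ} (h : ∀ x ∈ I, HasDerivWithinAt f (f' x) I x)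
    (hc : ContinuousOn f' I) : ContDiffOn ℝ 1 f I ∧ Set.EqOn (dI f) f' I := by
  have e : Set.EqOn (dI f) f' I := fun x hx => (h x hx).derivWithin (udI x hx)
  refine ⟨C1_iff.2 ⟨fun x hx => ?_, hc.congr e⟩, e⟩
  rw [e hx]; exact h x hx

lemma C2_iff {f : ℝ → ℝ} : ContDiffOn ℝ 2 f I ↔ ContDiffOn ℝ 1 f I ∧ ContDiffOn ℝ 1 (dI f) I := by
  have h2 : (2 : WithTop ℕ∞) = 1 + 1 := by norm_num
  constructor
  · intro h
    refine ⟨h.of_le (by norm_num), ?_⟩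
    rw [h2, contDiffOn_succ_iff_derivWithin udI] at h
    exact h.2.2
  · rintro ⟨ha, hb⟩
    rw [h2, contDiffOn_succ_iff_derivWithin udI]
    refine ⟨ha.differentiableOn (by norm_num), ?_, hb⟩
    intro h
    exact absurd h (by decide)

/-- weighted derivative bound -/
def N1 (f : ℝ → ℝ) (m : ℝ) : Prop := ∀ x ∈ I, |f x + (1 + x) * dI f x| ≤ m

/-- derivative of the weight -/
noncomputable def pd (x : ℝ) (n : ℕ) : ℝ :=
  (n:ℝ) / ((n:ℝ) + 1 + x) ^ 2 - ((n:ℝ) + 1) / ((n:ℝ) + 2 + x) ^ 2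

lemma pd_eq {x : ℝ} (hx : x ∈ I) (n : ℕ) : pd x n =
    (((n:ℝ) + 1 + x) * ((n:ℝ) + 2 + x) - (1 + x) * (2 * ((n:ℝ) + 1 + x) + 1)) /
      (((n:ℝ) + 1 + x) ^ 2 * ((n:ℝ) + 2 + x) ^ 2) := by
  have h1 := one_le_m hx n
  have h2 : (n:ℝ) + 1 + x ≠ 0 := by linarith
  have h3 : (n:ℝ) + 2 + x ≠ 0 := by linarith
  unfold pd
  field_simp
  ring

lemma pd_abs {x : ℝ} (hx : x ∈ I) (n : ℕ) (hn : 1 ≤ n) :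
    |pd x n| ≤ 1 / (((n:ℝ) + 1 + x) * ((n:ℝ) + 2 + x)) := by
  have h1 := one_le_m hx n
  have hn' : (1:ℝ) ≤ n := by exact_mod_cast hn
  obtain ⟨hx0, hx1⟩ := hx
  have e : 1 / (((n:ℝ) + 1 + x) * ((n:ℝ) + 2 + x)) =
    (((n:ℝ) + 1 + x) * ((n:ℝ) + 2 + x)) / (((n:ℝ) + 1 + x) ^ 2 * ((n:ℝ) + 2 + x) ^ 2) := by
    have h2 : (n:ℝ) + 1 + x ≠ 0 := by linarith
    have h3 : (n:ℝ) + 2 + x ≠ 0 := by linarith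
    field_simp
  rw [pd_eq ⟨hx0, hx1⟩, e, abs_div, abs_of_pos
    (a := ((n:ℝ) + 1 + x) ^ 2 * ((n:ℝ) + 2 + x) ^ 2) (by positivity)]
  apply div_le_div_of_nonneg_right _ (by positivity)
  rw [abs_le]
  constructor <;> nlinarith

lemma pd_nonneg {x : ℝ} (hx : x ∈ I) (n : ℕ) (hn : 2 ≤ n) : 0 ≤ pd x n := by
  have h1 := one_le_m hx n
  have hn' : (2:ℝ) ≤ n := by exact_mod_cast hn
  rw [pd_eq hx]
  obtain ⟨hx0, hx1⟩ := hx
  apply div_nonneg _ (by positivity)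
  nlinarith

lemma pd_summable {x : ℝ} (hx : x ∈ I) : Summable (pd x) := by
  rw [← summable_nat_add_iff 1]
  refine Summable.of_norm_bounded ((summable_nat_add_iff 1).2 zs_summable) fun n => ?_
  refine (pd_abs hx (n+1) (by omega)).trans (le_trans ?_ (inv_le_zs hx (n+1) 2 le_rfl))
  have h1 := one_le_m hx (n+1)
  apply one_div_le_one_div_of_le (by positivity)
  nlinarith

lemma pd_tsum {x : ℝ} (hx : x ∈ I) : ∑' n, pd x n = 0 := by
  set a : ℕ → ℝ := fun n => (n:ℝ) / ((n:ℝ) + 1 + x) ^ 2 with ha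
  have e : pd x = fun n => a n - a (n+1) := by
    funext n
    simp only [pd, ha]; push_cast
    rw [show (n:ℝ) + 1 + 1 + x = n + 2 + x by ring]
  have hl : Tendsto a atTop (𝓝 0) := by
    refine squeeze_zero (fun n => div_nonneg n.cast_nonneg (sq_nonneg _)) (fun n => ?_) (tendsto_inv_m x)
    have h1 := one_le_m hx n
    simp only [ha]
    rw [div_le_div_iff₀ (by positivity) (by positivity)]
    have : (0:ℝ) ≤ n := n.cast_nonneg
    nlinarith [hx.1]
  have hs := pd_summable hx
  rw [e] at hs
  rw [e]
  refine (tele hs hl).trans ?_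
  simp [ha]

/-- bound for the first kernel sum -/
lemma p_bound {x : ℝ} (hx : x ∈ I) (n : ℕ) (hn : 1 ≤ n) :
    (1 + x) / (((n:ℝ) + 1 + x) ^ 3 * ((n:ℝ) + 2 + x)) ≤
      (1/3) / (((n:ℝ) + x) * ((n:ℝ) + 1 + x)) - (1/3) / (((n:ℝ) + 1 + x) * ((n:ℝ) + 2 + x)) := by
  have hn' : (1:ℝ) ≤ n := by exact_mod_cast hn
  obtain ⟨hx0, hx1⟩ := hx
  have h0 : 0 < (n:ℝ) + x := by linarith
  have h1 : 0 < (n:ℝ) + 1 + x := by linarith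
  have h2 : 0 < (n:ℝ) + 2 + x := by linarith
  have e : (1/3) / (((n:ℝ) + x) * ((n:ℝ) + 1 + x)) - (1/3) / (((n:ℝ) + 1 + x) * ((n:ℝ) + 2 + x))
    = (2/3) / (((n:ℝ) + x) * ((n:ℝ) + 1 + x) * ((n:ℝ) + 2 + x)) := by
    field_simp; ring
  rw [e, div_le_div_iff₀ (by positivity) (by positivity)]
  have key : (1 + x) * ((n:ℝ) + x) ≤ 2/3 * ((n:ℝ) + 1 + x) ^ 2 := by nlinarith
  have : 0 ≤ ((n:ℝ) + 1 + x) * ((n:ℝ) + 2 + x) := by positivity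
  nlinarith [mul_le_mul_of_nonneg_right key this]

lemma p0_bound {x : ℝ} (hx : x ∈ I) : (1 + x) / ((1 + x) ^ 3 * (2 + x)) ≤ 1 / 2 := by
  obtain ⟨hx0, hx1⟩ := hx
  rw [div_le_div_iff₀ (by positivity) (by norm_num)]
  nlinarith [mul_nonneg hx0 hx0, mul_nonneg (mul_nonneg hx0 hx0) hx0]

lemma p1_bound {x : ℝ} (hx : x ∈ I) : (1 + x) / ((2 + x) ^ 3 * (3 + x)) ≤ 1 / 18 := by
  obtain ⟨hx0, hx1⟩ := hx
  rw [div_le_div_iff₀ (by positivity) (by norm_num)]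
  have h1 : (4:ℝ) ≤ (2 + x)^2 := by nlinarith
  have h2 : (2 + x) * (3 + x) * 2 ≥ 9 * (1 + x) := by nlinarith
  have : (0:ℝ) ≤ (2 + x) * (3 + x) := by positivity
  nlinarith [mul_le_mul_of_nonneg_right h1 this]

/-- abstract summation bound -/
lemma sum_bound {T : ℕ → ℝ} {M : ℝ} (hM : 0 ≤ M) {x : ℝ} (hx : x ∈ I)
    (h0 : |T 0| ≤ M * (1/2)) (h1 : |T 1| ≤ M * (1/18 + 1/12))
    (h2 : ∀ n, 2 ≤ n → |T n| ≤ M * ((1 + x) / (((n:ℝ) + 1 + x) ^ 3 * ((n:ℝ) + 2 + x)) + pd x n)) :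
    Summable T ∧ |∑' n, T n| ≤ 11 / 12 * M := by
  set U : ℕ → ℝ := fun n => (1/3) / (((n:ℝ) + x) * ((n:ℝ) + 1 + x)) +
    (n:ℝ) / ((n:ℝ) + 1 + x) ^ 2 with hU
  have hx0 := hx.1
  have hUn : ∀ n, 0 ≤ U n := fun n => by simp only [hU]; positivity
  have hU2 : U 2 ≤ 1/18 + 2/9 := by
    simp only [hU]
    push_cast
    apply add_le_add
    · rw [div_le_div_iff₀ (by positivity) (by norm_num)]; nlinarith
    · rw [div_le_div_iff₀ (by positivity) (by norm_num)]; nlinarith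
  have step : ∀ n, 2 ≤ n → |T n| ≤ M * (U n - U (n+1)) := by
    intro n hn
    refine (h2 n hn).trans (mul_le_mul_of_nonneg_left ?_ hM)
    have := p_bound hx n (by omega)
    simp only [hU, pd]
    push_cast
    rw [show (n:ℝ) + 1 + 1 + x = n + 2 + x by ring]
    linarith
  have part : ∀ K, ∑ i ∈ Finset.range (K + 2), |T i| ≤ M * (23/36 + 5/18 - U (K+2)) := by
    intro K
    induction K with
    | zero =>
      simp only [zero_add, Finset.sum_range_succ, Finset.sum_range_zero]
      nlinarith
    | succ K ih =>
      rw [show K + 1 + 2 = (K + 2) + 1 by ring, Finset.sum_range_succ]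
      have := step (K+2) (by omega)
      nlinarith
  have part' : ∀ K, ∑ i ∈ Finset.range K, |T i| ≤ 11/12 * M := by
    intro K
    calc _ ≤ ∑ i ∈ Finset.range (K + 2), |T i| :=
          Finset.sum_le_sum_of_subset_of_nonneg
            (Finset.range_mono (by omega)) (fun _ _ _ => abs_nonneg _)
      _ ≤ _ := part K
      _ ≤ _ := by nlinarith [mul_nonneg hM (hUn (K+2))]
  have hs := summable_of_sum_range_le (fun n => abs_nonneg (T n)) part'
  refine ⟨hs.of_abs, ?_⟩
  have h3 := norm_tsum_le_tsum_norm (f := T) hs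
  exact h3.trans (Real.tsum_le_of_sum_range_le (fun n => abs_nonneg (T n)) part')

lemma LG_deriv {f : ℝ → ℝ} (hf : ContDiffOn ℝ 1 f I) : ∀ x ∈ I, HasDerivWithinAt (LG f)
    (- S 0 1 4 (dI f) x - 2 * S 0 1 3 f x) I x := by
  intro x hx
  have := S_deriv brG (k := 2) le_rfl (C1_iff.1 hf).1 (C1_iff.1 hf).2 x hx
  rw [LG_eq]
  simpa using this

lemma LR_deriv {f : ℝ → ℝ} (hf : ContDiffOn ℝ 1 f I) : ∀ x ∈ I, HasDerivWithinAt (LR f)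
    (S 1 (-1) 4 (dI f) x - 2 * S 1 (-1) 3 f x) I x := by
  intro x hx
  have := S_deriv brR (k := 2) le_rfl (C1_iff.1 hf).1 (C1_iff.1 hf).2 x hx
  rw [LR_eq]
  simpa using this

lemma contraction {f : ℝ → ℝ} {M : ℝ} (hf : ContDiffOn ℝ 1 f I) (hN : N1 f M) :
    N1 (LG f) (11/12 * M) := by
  obtain ⟨hd, hc⟩ := C1_iff.1 hf
  have hfc : ContinuousOn f I := hf.continuousOn
  obtain ⟨m0, hm0⟩ := bdd_of_cont hfc
  obtain ⟨m1, hm1⟩ := bdd_of_cont hc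
  have hM : 0 ≤ M := (abs_nonneg _).trans (hN 0 ⟨le_rfl, by norm_num⟩)
  set G : ℝ → ℝ := fun t => (1 + t) * f t with hG
  set D : ℝ → ℝ := fun t => f t + (1 + t) * dI f t with hD
  have hGd : ∀ t ∈ I, HasDerivWithinAt G (D t) I t := by
    intro t ht
    have := ((hasDerivWithinAt_id t I).const_add 1).mul (hd t ht)
    refine HasDerivWithinAt.congr_deriv this ?_
    simp [hD]
  have hLip : ∀ s ∈ I, ∀ t ∈ I, |G t - G s| ≤ M * |t - s| := fun s hs t ht =>
    (convex_Icc 0 1).norm_image_sub_le_of_norm_hasDerivWithin_le hGd hN hs ht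
  intro x hx
  have hdx : dI (LG f) x = _ := (LG_deriv hf x hx).derivWithin (udI x hx)
  rw [hdx, LG_eq]
  have hx0 := hx.1
  have hx1 := hx.2
  set φ : ℕ → ℝ := fun n => 0 + 1 / ((n:ℝ) + 1 + x) with hφ
  have hφI : ∀ n, φ n ∈ I := fun n => brG.m _ (one_le_m hx n)
  set T : ℕ → ℝ := fun n => -((1 + x) / (((n:ℝ) + 1 + x) ^ 3 * ((n:ℝ) + 2 + x))) * D (φ n)
    + pd x n * (G (φ n) - G (φ 0)) with hT
  have hTb : ∀ n, |T n| ≤ M * ((1 + x) / (((n:ℝ) + 1 + x) ^ 3 * ((n:ℝ) + 2 + x)))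
      + |pd x n| * (M * |φ n - φ 0|) := by
    intro n
    refine (abs_add_le _ _).trans (add_le_add ?_ ?_)
    · rw [abs_mul, abs_neg, abs_of_nonneg
        (a := (1 + x) / (((n:ℝ) + 1 + x) ^ 3 * ((n:ℝ) + 2 + x))) (by positivity), mul_comm]
      exact mul_le_mul_of_nonneg_right (hN _ (hφI n)) (by positivity)
    · rw [abs_mul]
      exact mul_le_mul_of_nonneg_left (hLip _ (hφI 0) _ (hφI n)) (abs_nonneg _)
  have g0 : |T 0| ≤ M * (1/2) := by
    have := hTb 0
    simp only [sub_self, abs_zero, mul_zero, add_zero, Nat.cast_zero, zero_add] at this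
    exact this.trans (mul_le_mul_of_nonneg_left (p0_bound hx) hM)
  have g1 : |T 1| ≤ M * (1/18 + 1/12) := by
    refine (hTb 1).trans ?_
    have a1 := p1_bound hx
    have a2 := pd_abs hx 1 le_rfl
    have a3 : |φ 1 - φ 0| ≤ 1 / 2 := by
      simp only [hφ]
      push_cast
      have : 0 + 1 / (1 + 1 + x) - (0 + 1 / (0 + 1 + x)) = - (1 / ((1 + x) * (2 + x))) := by
        have : 1 + x ≠ 0 := by positivity
        have : 2 + x ≠ 0 := by positivity
        rw [show (1:ℝ) + 1 + x = 2 + x by ring, show (0:ℝ) + 1 + x = 1 + x by ring]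
        field_simp; ring
      rw [this, abs_neg, abs_of_nonneg (by positivity)]
      apply one_div_le_one_div_of_le (by norm_num); nlinarith
    have a4 : |pd x 1| ≤ 1 / 6 := by
      refine a2.trans ?_
      apply one_div_le_one_div_of_le (by norm_num); push_cast; nlinarith
    have a5 : (1 + x) / ((((1:ℕ):ℝ) + 1 + x) ^ 3 * (((1:ℕ):ℝ) + 2 + x)) ≤ 1 / 18 := by
      convert a1 using 3 <;> push_cast <;> ring
    have a6 : |pd x 1| * |φ 1 - φ 0| ≤ 1/6 * (1/2) :=
      mul_le_mul a4 a3 (abs_nonneg _) (by norm_num)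
    calc _ = M * ((1 + x) / ((((1:ℕ):ℝ) + 1 + x) ^ 3 * (((1:ℕ):ℝ) + 2 + x))
          + |pd x 1| * |φ 1 - φ 0|) := by ring
      _ ≤ _ := by
        apply mul_le_mul_of_nonneg_left _ hM; linarith
  have g2 : ∀ n, 2 ≤ n → |T n| ≤ M * ((1 + x) / (((n:ℝ) + 1 + x) ^ 3 * ((n:ℝ) + 2 + x)) + pd x n) := by
    intro n hn
    refine (hTb n).trans ?_
    have a1 := pd_nonneg hx n hn
    have a2 : |φ n - φ 0| ≤ 1 := by
      have b1 := hφI n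
      have b2 := hφI 0
      rw [abs_le]; constructor <;> linarith [b1.1, b1.2, b2.1, b2.2]
    rw [abs_of_nonneg a1]
    have : pd x n * (M * |φ n - φ 0|) ≤ M * pd x n := by
      nlinarith [mul_nonneg a1 hM]
    linarith
  obtain ⟨hsT, hbT⟩ := sum_bound (T := T) hM hx g0 g1 g2
  suffices hh : S 0 1 2 f x + (1 + x) * (-S 0 1 4 (dI f) x - 2 * S 0 1 3 f x) = ∑' n, T n by
    rw [hh]; exact hbT
  have s2 := S_summable brG (k := 2) (by norm_num) hm0 hx
  have s3 := S_summable brG (k := 3) (by norm_num) hm0 hx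
  have s4 := S_summable brG (k := 4) (by norm_num) hm1 hx
  have e1 : S 0 1 2 f x + (1 + x) * (-S 0 1 4 (dI f) x - 2 * S 0 1 3 f x)
    = ∑' n, (T n + G (φ 0) * pd x n) := by
    unfold S
    rw [← tsum_neg, ← tsum_mul_left, ← Summable.tsum_sub s4.neg (s3.mul_left 2),
      ← tsum_mul_left, ← Summable.tsum_add s2 ((s4.neg.sub (s3.mul_left 2)).mul_left _)]
    refine tsum_congr fun n => ?_
    have h1 := one_le_m hx n
    have h2 : (n:ℝ) + 1 + x ≠ 0 := by linarith
    have h3 : (n:ℝ) + 2 + x ≠ 0 := by linarith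
    simp only [hT]
    change _ = _ * D (φ n) + pd x n * (G (φ n) - G (φ 0)) + G (φ 0) * pd x n
    have e2 : ∀ A, A + pd x n * (G (φ n) - G (φ 0)) + G (φ 0) * pd x n = A + pd x n * G (φ n) := by
      intro A; ring
    rw [e2, pd_eq hx]
    change f (φ n) / _ + (1 + x) * (-(dI f (φ n) / _) - 2 * (f (φ n) / _)) = 
      _ * (f (φ n) + (1 + φ n) * dI f (φ n)) + _ * ((1 + φ n) * f (φ n))
    generalize f (φ n) = a
    generalize dI f (φ n) = b
    have e3 : 1 + φ n = ((n:ℝ) + 2 + x) / ((n:ℝ) + 1 + x) := by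
      simp only [hφ]; field_simp; ring
    rw [e3]
    field_simp
    ring
  rw [e1, Summable.tsum_add hsT ((pd_summable hx).mul_left _), tsum_mul_left, pd_tsum hx]
  ring

open Filter Topology
lemma zm_bound {f : ℝ → ℝ} {m : ℝ} (hf : ContDiffOn ℝ 1 f I) (hi : ∫ x in (0:ℝ)..1, f x = 0)
    (hN : N1 f m) : ∀ x ∈ I, |f x| ≤ m ∧ |dI f x| ≤ 2 * m := by
  obtain ⟨hd, hc⟩ := C1_iff.1 hf
  obtain ⟨F, hF, hFi⟩ := prim hf.continuousOn
  obtain ⟨t, ht, het⟩ := exists_hasDerivAt_eq_slope F f (zero_lt_one)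
    (fun x hx => (hF x hx).continuousWithinAt)
    (fun x hx => (hF x ⟨hx.1.le, hx.2.le⟩).hasDerivAt (Icc_mem_nhds hx.1 hx.2))
  rw [← hFi, hi, zero_div] at het
  have htI : t ∈ I := ⟨ht.1.le, ht.2.le⟩
  have hm : 0 ≤ m := (abs_nonneg _).trans (hN 0 ⟨le_rfl, by norm_num⟩)
  have hGd : ∀ t ∈ I, HasDerivWithinAt (fun t => (1 + t) * f t) (f t + (1 + t) * dI f t) I t := by
    intro t ht
    have := ((hasDerivWithinAt_id t I).const_add 1).mul (hd t ht)
    refine HasDerivWithinAt.congr_deriv this ?_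
    simp
  intro x hx
  have h1 := (convex_Icc (0:ℝ) 1).norm_image_sub_le_of_norm_hasDerivWithin_le hGd hN htI hx
  simp only [het, mul_zero, sub_zero, Real.norm_eq_abs] at h1
  have hxt : |x - t| ≤ 1 := by
    rw [abs_le]; constructor <;> linarith [hx.1, hx.2, htI.1, htI.2]
  have h2 : |(1 + x) * f x| ≤ m := h1.trans (by nlinarith)
  have h3 : |f x| ≤ m := by
    refine le_trans ?_ h2
    rw [abs_mul, abs_of_nonneg (by linarith [hx.1] : 0 ≤ 1 + x)]
    nlinarith [abs_nonneg (f x), hx.1]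
  refine ⟨h3, ?_⟩
  have h4 : |(1 + x) * dI f x| ≤ 2 * m := by
    have : (1 + x) * dI f x = (f x + (1 + x) * dI f x) - f x := by ring
    rw [this]
    refine (abs_sub _ _).trans ?_
    linarith [hN x hx]
  refine le_trans ?_ h4
  rw [abs_mul, abs_of_nonneg (by linarith [hx.1] : 0 ≤ 1 + x)]
  nlinarith [abs_nonneg (dI f x), hx.1]

lemma LG_C1 {f : ℝ → ℝ} (hf : ContDiffOn ℝ 1 f I) : ContDiffOn ℝ 1 (LG f) I ∧
    Set.EqOn (dI (LG f)) (fun x => - S 0 1 4 (dI f) x - 2 * S 0 1 3 f x) I :=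
  C1_of (LG_deriv hf) ((S_cont brG (by norm_num) (C1_iff.1 hf).2).neg.sub
    (continuousOn_const.mul (S_cont brG (by norm_num) hf.continuousOn)))

lemma LR_C1 {f : ℝ → ℝ} (hf : ContDiffOn ℝ 1 f I) : ContDiffOn ℝ 1 (LR f) I ∧
    Set.EqOn (dI (LR f)) (fun x => S 1 (-1) 4 (dI f) x - 2 * S 1 (-1) 3 f x) I :=
  C1_of (LR_deriv hf) ((S_cont brR (by norm_num) (C1_iff.1 hf).2).sub
    (continuousOn_const.mul (S_cont brR (by norm_num) hf.continuousOn)))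

lemma comb_C1 {f g : ℝ → ℝ} (hf : ContDiffOn ℝ 1 f I) (hg : ContDiffOn ℝ 1 g I) (a b : ℝ) :
    ContDiffOn ℝ 1 (fun x => a * f x + b * g x) I ∧
    Set.EqOn (dI (fun x => a * f x + b * g x)) (fun x => a * dI f x + b * dI g x) I := by
  obtain ⟨hd, hc⟩ := C1_iff.1 hf
  obtain ⟨hd', hc'⟩ := C1_iff.1 hg
  exact C1_of (fun x hx => ((hd x hx).const_mul a).add ((hd' x hx).const_mul b))
    ((continuousOn_const.mul hc).add (continuousOn_const.mul hc'))

lemma Le_C1 (ε : ℝ) {f : ℝ → ℝ} (hf : ContDiffOn ℝ 1 f I) : ContDiffOn ℝ 1 (Le ε f) I ∧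
    Set.EqOn (dI (Le ε f)) (fun x => (1 - ε) * dI (LG f) x + ε * dI (LR f) x) I :=
  comb_C1 (LG_C1 hf).1 (LR_C1 hf).1 _ _

lemma comb_N1 {f g : ℝ → ℝ} (hf : ContDiffOn ℝ 1 f I) (hg : ContDiffOn ℝ 1 g I) (a b : ℝ)
    {m m' : ℝ} (h1 : N1 f m) (h2 : N1 g m') :
    N1 (fun x => a * f x + b * g x) (|a| * m + |b| * m') := by
  intro x hx
  rw [(comb_C1 hf hg a b).2 hx]
  have : a * f x + b * g x + (1 + x) * (a * dI f x + b * dI g x) =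
    a * (f x + (1 + x) * dI f x) + b * (g x + (1 + x) * dI g x) := by ring
  simp only [this]
  refine (abs_add_le _ _).trans ?_
  rw [abs_mul, abs_mul]
  exact add_le_add (mul_le_mul_of_nonneg_left (h1 x hx) (abs_nonneg _))
    (mul_le_mul_of_nonneg_left (h2 x hx) (abs_nonneg _))

lemma LR_N1 {f : ℝ → ℝ} {m : ℝ} (hf : ContDiffOn ℝ 1 f I)
    (hb : ∀ x ∈ I, |f x| ≤ m ∧ |dI f x| ≤ 2 * m) : N1 (LR f) (9 * Z * m) := by
  intro x hx
  rw [(LR_C1 hf).2 hx, LR_eq]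
  have a1 := S_bound brR (k := 2) le_rfl (fun x hx => (hb x hx).1) hx
  have a2 := S_bound brR (k := 3) (by norm_num) (fun x hx => (hb x hx).1) hx
  have a3 := S_bound brR (k := 4) (by norm_num) (fun x hx => (hb x hx).2) hx
  have hmZ : 0 ≤ m * Z := mul_nonneg ((abs_nonneg _).trans (hb x hx).1) Z_nonneg
  have a4 : |S 1 (-1) 4 (dI f) x - 2 * S 1 (-1) 3 f x| ≤ 4 * (m * Z) := by
    refine (abs_sub _ _).trans ?_
    rw [abs_mul, abs_two]; linarith
  refine (abs_add_le _ _).trans ?_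
  rw [abs_mul (1 + x), abs_of_nonneg (by linarith [hx.1] : 0 ≤ 1 + x)]
  nlinarith [hx.1, hx.2, mul_le_mul_of_nonneg_left a4 (by linarith [hx.1] : 0 ≤ 1 + x)]

/-- contraction for the annealed operator -/
lemma Le_N1 {ε : ℝ} (h0 : 0 ≤ ε) (h1 : ε ≤ 1) (hZ : 9 * Z * ε ≤ 1 / 24) {f : ℝ → ℝ} {m : ℝ}
    (hf : ContDiffOn ℝ 1 f I) (hi : ∫ x in (0:ℝ)..1, f x = 0) (hN : N1 f m) :
    N1 (Le ε f) (23 / 24 * m) := by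
  have hm : 0 ≤ m := (abs_nonneg _).trans (hN 0 ⟨le_rfl, by norm_num⟩)
  have := comb_N1 (LG_C1 hf).1 (LR_C1 hf).1 (1 - ε) ε (contraction hf hN)
    (LR_N1 hf (zm_bound hf hi hN))
  intro x hx
  refine (this x hx).trans ?_
  rw [abs_of_nonneg h0, abs_of_nonneg (by linarith : 0 ≤ 1 - ε)]
  nlinarith [mul_le_mul_of_nonneg_right hZ hm, mul_nonneg h0 hm]

/-- weighted second derivative bound -/
def N2 (f : ℝ → ℝ) (m : ℝ) : Prop := ∀ x ∈ I, |(1 + x) * dI (dI f) x| ≤ m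

lemma LG_C2 {f : ℝ → ℝ} (hf : ContDiffOn ℝ 2 f I) : ContDiffOn ℝ 2 (LG f) I ∧
    Set.EqOn (dI (dI (LG f)))
      (fun x => S 0 1 6 (dI (dI f)) x + 6 * S 0 1 5 (dI f) x + 6 * S 0 1 4 f x) I := by
  obtain ⟨hf1, hf2⟩ := C2_iff.1 hf
  obtain ⟨hd, hc⟩ := C1_iff.1 hf1
  obtain ⟨hd2, hc2⟩ := C1_iff.1 hf2
  obtain ⟨g1, g2⟩ := LG_C1 hf1
  have key : ∀ x ∈ I, HasDerivWithinAt (dI (LG f))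
      (S 0 1 6 (dI (dI f)) x + 6 * S 0 1 5 (dI f) x + 6 * S 0 1 4 f x) I x := by
    intro x hx
    have := (S_deriv brG (k := 4) (by norm_num) hd2 hc2 x hx).neg.sub
      ((S_deriv brG (k := 3) (by norm_num) hd hc x hx).const_mul 2)
    refine (HasDerivWithinAt.congr_deriv this ?_).congr g2 (g2 hx)
    push_cast
    ring
  obtain ⟨k1, k2⟩ := C1_of key (((S_cont brG (by norm_num) hc2).add (continuousOn_const.mul
    (S_cont brG (by norm_num) hc))).add (continuousOn_const.mul
    (S_cont brG (by norm_num) hf.continuousOn)))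
  exact ⟨C2_iff.2 ⟨g1, k1⟩, k2⟩

lemma LR_C2 {f : ℝ → ℝ} (hf : ContDiffOn ℝ 2 f I) : ContDiffOn ℝ 2 (LR f) I ∧
    Set.EqOn (dI (dI (LR f)))
      (fun x => S 1 (-1) 6 (dI (dI f)) x - 6 * S 1 (-1) 5 (dI f) x + 6 * S 1 (-1) 4 f x) I := by
  obtain ⟨hf1, hf2⟩ := C2_iff.1 hf
  obtain ⟨hd, hc⟩ := C1_iff.1 hf1
  obtain ⟨hd2, hc2⟩ := C1_iff.1 hf2
  obtain ⟨g1, g2⟩ := LR_C1 hf1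
  have key : ∀ x ∈ I, HasDerivWithinAt (dI (LR f))
      (S 1 (-1) 6 (dI (dI f)) x - 6 * S 1 (-1) 5 (dI f) x + 6 * S 1 (-1) 4 f x) I x := by
    intro x hx
    have := (S_deriv brR (k := 4) (by norm_num) hd2 hc2 x hx).sub
      ((S_deriv brR (k := 3) (by norm_num) hd hc x hx).const_mul 2)
    refine (HasDerivWithinAt.congr_deriv this ?_).congr g2 (g2 hx)
    push_cast
    ring
  obtain ⟨k1, k2⟩ := C1_of key (((S_cont brR (by norm_num) hc2).sub (continuousOn_const.mul
    (S_cont brR (by norm_num) hc))).add (continuousOn_const.mul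
    (S_cont brR (by norm_num) hf.continuousOn)))
  exact ⟨C2_iff.2 ⟨g1, k1⟩, k2⟩

lemma Le_C2 (ε : ℝ) {f : ℝ → ℝ} (hf : ContDiffOn ℝ 2 f I) : ContDiffOn ℝ 2 (Le ε f) I ∧
    Set.EqOn (dI (dI (Le ε f)))
      (fun x => (1 - ε) * dI (dI (LG f)) x + ε * dI (dI (LR f)) x) I := by
  have hf1 := (C2_iff.1 hf).1
  obtain ⟨a1, a2⟩ := Le_C1 ε hf1
  obtain ⟨b1, b2⟩ := comb_C1 (C2_iff.1 (LG_C2 hf).1).2 (C2_iff.1 (LR_C2 hf).1).2 (1 - ε) ε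
  refine ⟨C2_iff.2 ⟨a1, b1.congr a2⟩, fun x hx => ?_⟩
  rw [← b2 hx]
  exact derivWithin_congr a2 (a2 hx)

lemma S6_bound {g : ℝ → ℝ} {m : ℝ} (hg : ∀ x ∈ I, |(1 + x) * g x| ≤ m) {x : ℝ} (hx : x ∈ I) :
    |(1 + x) * S 0 1 6 g x| ≤ 11 / 12 * m := by
  have hm : 0 ≤ m := (abs_nonneg _).trans (hg 0 ⟨le_rfl, by norm_num⟩)
  have hx0 := hx.1
  set T : ℕ → ℝ := fun n => (1 + x) * (g (0 + 1 / ((n:ℝ) + 1 + x)) / ((n:ℝ) + 1 + x) ^ 6) with hT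
  have hTb : ∀ n, |T n| ≤ m * ((1 + x) / (((n:ℝ) + 1 + x) ^ 3 * ((n:ℝ) + 2 + x))) := by
    intro n
    have h1 := one_le_m hx n
    have h2 : 0 < (n:ℝ) + 1 + x := by linarith
    have h3 : 0 < (n:ℝ) + 2 + x := by linarith
    have a1 := hg _ (brG.m _ h1)
    set y := g (0 + 1 / ((n:ℝ) + 1 + x)) with hy
    have e3 : 1 + (0 + 1 / ((n:ℝ) + 1 + x)) = ((n:ℝ) + 2 + x) / ((n:ℝ) + 1 + x) := by
      field_simp; ring
    rw [e3] at a1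
    have e4 : T n = ((((n:ℝ) + 2 + x) / ((n:ℝ) + 1 + x)) * y) *
        (((1 + x) / (((n:ℝ) + 1 + x) ^ 3 * ((n:ℝ) + 2 + x))) * (1 / ((n:ℝ) + 1 + x) ^ 2)) := by
      simp only [hT, ← hy]
      field_simp
    rw [e4, abs_mul, abs_of_nonneg (a := _ * (1 / ((n:ℝ) + 1 + x) ^ 2)) (by positivity)]
    refine mul_le_mul a1 ?_ (by positivity) hm
    refine mul_le_of_le_one_right (by positivity) ?_
    rw [div_le_one (by positivity)]
    exact one_le_pow₀ h1
  have h0 : |T 0| ≤ m * (1/2) := by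
    have := hTb 0
    simp only [Nat.cast_zero, zero_add] at this
    exact this.trans (mul_le_mul_of_nonneg_left (p0_bound hx) hm)
  have h1 : |T 1| ≤ m * (1/18 + 1/12) := by
    refine (hTb 1).trans (mul_le_mul_of_nonneg_left ?_ hm)
    have a5 : (1 + x) / ((((1:ℕ):ℝ) + 1 + x) ^ 3 * (((1:ℕ):ℝ) + 2 + x)) ≤ 1 / 18 := by
      convert p1_bound hx using 3 <;> push_cast <;> ring
    linarith
  have := (sum_bound hm hx h0 h1 (fun n hn => (hTb n).trans (mul_le_mul_of_nonneg_left
    (by linarith [pd_nonneg hx n hn]) hm))).2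
  rw [hT, tsum_mul_left] at this
  exact this

lemma Le_N2 {ε : ℝ} (h0 : 0 ≤ ε) (h1 : ε ≤ 1) (hZ : 9 * Z * ε ≤ 1 / 24) {f : ℝ → ℝ} {m m2 : ℝ}
    (hf : ContDiffOn ℝ 2 f I) (hb : ∀ x ∈ I, |f x| ≤ m ∧ |dI f x| ≤ 2 * m) (hN : N2 f m2) :
    N2 (Le ε f) (23 / 24 * m2 + 36 * Z * m) := by
  have hm : 0 ≤ m := (abs_nonneg _).trans (hb 0 ⟨le_rfl, by norm_num⟩).1
  have hm2 : 0 ≤ m2 := (abs_nonneg _).trans (hN 0 ⟨le_rfl, by norm_num⟩)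
  have hZ0 := Z_nonneg
  have hf2 : ∀ x ∈ I, |dI (dI f) x| ≤ m2 := by
    intro x hx
    refine le_trans ?_ (hN x hx)
    rw [abs_mul, abs_of_nonneg (by linarith [hx.1] : 0 ≤ 1 + x)]
    nlinarith [abs_nonneg (dI (dI f) x), hx.1]
  intro x hx
  have hx0 : 0 ≤ 1 + x := by linarith [hx.1]
  have hx2 : 1 + x ≤ 2 := by linarith [hx.2]
  have aux : ∀ {c σ : ℝ}, Br c σ → ∀ s : ℝ, |s| = 6 →
      |(1 + x) * (s * S c σ 5 (dI f) x + 6 * S c σ 4 f x)| ≤ 36 * Z * m := by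
    intro c σ hbr s hs
    have a1 := S_bound hbr (k := 4) (by norm_num) (fun x hx => (hb x hx).1) hx
    have a2 := S_bound hbr (k := 5) (by norm_num) (fun x hx => (hb x hx).2) hx
    have a3 : |s * S c σ 5 (dI f) x + 6 * S c σ 4 f x| ≤ 18 * (m * Z) := by
      refine (abs_add_le _ _).trans ?_
      rw [abs_mul, abs_mul, hs, abs_of_pos (by norm_num : (0:ℝ) < 6)]
      linarith
    rw [abs_mul, abs_of_nonneg hx0]
    nlinarith [abs_nonneg (s * S c σ 5 (dI f) x + 6 * S c σ 4 f x)]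
  have bG : |(1 + x) * dI (dI (LG f)) x| ≤ 11 / 12 * m2 + 36 * Z * m := by
    rw [(LG_C2 hf).2 hx]
    have := aux brG 6 (by norm_num)
    have e : (1 + x) * (S 0 1 6 (dI (dI f)) x + 6 * S 0 1 5 (dI f) x + 6 * S 0 1 4 f x) =
      (1 + x) * S 0 1 6 (dI (dI f)) x + (1 + x) * (6 * S 0 1 5 (dI f) x + 6 * S 0 1 4 f x) := by
      ring
    simp only [e]
    exact (abs_add_le _ _).trans (add_le_add (S6_bound hN hx) this)
  have bR : |(1 + x) * dI (dI (LR f)) x| ≤ 2 * Z * m2 + 36 * Z * m := by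
    rw [(LR_C2 hf).2 hx]
    have := aux brR (-6) (by norm_num)
    have e : (1 + x) * (S 1 (-1) 6 (dI (dI f)) x - 6 * S 1 (-1) 5 (dI f) x + 6 * S 1 (-1) 4 f x) =
      (1 + x) * S 1 (-1) 6 (dI (dI f)) x +
        (1 + x) * (-6 * S 1 (-1) 5 (dI f) x + 6 * S 1 (-1) 4 f x) := by
      ring
    simp only [e]
    refine (abs_add_le _ _).trans (add_le_add ?_ this)
    have a1 := S_bound brR (k := 6) (by norm_num) hf2 hx
    rw [abs_mul, abs_of_nonneg hx0]
    nlinarith [abs_nonneg (S 1 (-1) 6 (dI (dI f)) x)]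
  rw [(Le_C2 ε hf).2 hx]
  have e : (1 + x) * ((1 - ε) * dI (dI (LG f)) x + ε * dI (dI (LR f)) x) =
    (1 - ε) * ((1 + x) * dI (dI (LG f)) x) + ε * ((1 + x) * dI (dI (LR f)) x) := by ring
  simp only [e]
  refine (abs_add_le _ _).trans ?_
  rw [abs_mul (1 - ε), abs_mul ε, abs_of_nonneg h0, abs_of_nonneg (by linarith : 0 ≤ 1 - ε)]
  have c1 := mul_le_mul_of_nonneg_left bG (by linarith : 0 ≤ 1 - ε)
  have c2 := mul_le_mul_of_nonneg_left bR h0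
  have c3 := mul_le_mul_of_nonneg_right hZ hm2
  have c4 := mul_nonneg h0 hm2
  have c5 := mul_nonneg hZ0 (mul_nonneg h0 hm2)
  nlinarith

open Filter Topology
lemma S_tsum {c σ : ℝ} (hb : Br c σ) {f : ℕ → ℝ → ℝ} {u : ℕ → ℝ} (hu : Summable u)
    (hf : ∀ k, ∀ x ∈ I, |f k x| ≤ u k) {x : ℝ} (hx : x ∈ I) :
    S c σ 2 (fun y => ∑' k, f k y) x = ∑' k, S c σ 2 (f k) x := by
  have hu0 : ∀ k, 0 ≤ u k := fun k => (abs_nonneg _).trans (hf k x hx)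
  unfold S
  simp_rw [← tsum_div_const]
  refine Summable.tsum_comm (f := fun k (n:ℕ) => f k (c + σ / ((n:ℝ) + 1 + x)) / ((n:ℝ) + 1 + x) ^ 2) ?_
  refine Summable.of_norm_bounded (hu.mul_of_nonneg zs_summable hu0 zs_nonneg) ?_
  rintro ⟨k, n⟩
  exact term_bound hb le_rfl (hf k) hx n

lemma Le_tsum (ε : ℝ) {f : ℕ → ℝ → ℝ} {u : ℕ → ℝ} (hu : Summable u)
    (hf : ∀ k, ∀ x ∈ I, |f k x| ≤ u k) {x : ℝ} (hx : x ∈ I) :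
    Le ε (fun y => ∑' k, f k y) x = ∑' k, Le ε (f k) x := by
  have s : ∀ {c σ : ℝ}, Br c σ → Summable fun k => S c σ 2 (f k) x := fun hb =>
    Summable.of_norm_bounded (hu.mul_right Z) (fun k => S_bound hb le_rfl (hf k) hx)
  unfold Le
  rw [LG_eq, LR_eq, S_tsum brG hu hf hx, S_tsum brR hu hf hx,
    Summable.tsum_add ((s brG).mul_left _) ((s brR).mul_left _), tsum_mul_left, tsum_mul_left]

lemma iter_prop {ε : ℝ} (h0 : 0 ≤ ε) (h1 : ε ≤ 1) (hZ : 9 * Z * ε ≤ 1 / 24) {q : ℝ → ℝ} {m : ℝ}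
    (hq : ContDiffOn ℝ 1 q I) (hi : ∫ x in (0:ℝ)..1, q x = 0) (hN : N1 q m) (k : ℕ) :
    ContDiffOn ℝ 1 ((Le ε)^[k] q) I ∧ ∫ x in (0:ℝ)..1, (Le ε)^[k] q x = 0 ∧
      N1 ((Le ε)^[k] q) ((23/24)^k * m) := by
  induction k with
  | zero => simpa using ⟨hq, hi, hN⟩
  | succ k ih =>
    obtain ⟨a, b, c⟩ := ih
    rw [Function.iterate_succ_apply']
    refine ⟨(Le_C1 ε a).1, (int_Le ε a.continuousOn).trans b, ?_⟩
    have := Le_N1 h0 h1 hZ a b c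
    rw [pow_succ]
    intro x hx
    refine (this x hx).trans (le_of_eq (by ring))

lemma iter_N2 {ε : ℝ} (h0 : 0 ≤ ε) (h1 : ε ≤ 1) (hZ : 9 * Z * ε ≤ 1 / 24) {q : ℝ → ℝ} {m : ℝ}
    (hq : ContDiffOn ℝ 2 q I) (hi : ∫ x in (0:ℝ)..1, q x = 0) (hN : N1 q m) :
    ∃ B, ∀ k, ContDiffOn ℝ 2 ((Le ε)^[k] q) I ∧ N2 ((Le ε)^[k] q) (B * (47/48)^k) := by
  have hm : 0 ≤ m := (abs_nonneg _).trans (hN 0 ⟨le_rfl, by norm_num⟩)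
  have hq1 := (C2_iff.1 hq).1
  obtain ⟨b, hb⟩ := bdd_of_cont (f := fun x => (1 + x) * dI (dI q) x)
    ((continuousOn_const.add continuousOn_id).mul (C1_iff.1 (C2_iff.1 hq).2).2)
  have hZ0 := Z_nonneg
  have hb0 : 0 ≤ b := (abs_nonneg _).trans (hb 0 ⟨le_rfl, by norm_num⟩)
  refine ⟨b + 48 * (36 * Z * m), fun k => ?_⟩
  induction k with
  | zero =>
    refine ⟨hq, fun x hx => (hb x hx).trans ?_⟩
    have : 0 ≤ Z * m := mul_nonneg hZ0 hm
    simp only [pow_zero, mul_one]; nlinarith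
  | succ k ih =>
    obtain ⟨a, c⟩ := ih
    obtain ⟨d1, d2, d3⟩ := iter_prop h0 h1 hZ hq1 hi hN k
    rw [Function.iterate_succ_apply']
    refine ⟨(Le_C2 ε a).1, fun x hx => ?_⟩
    refine (Le_N2 h0 h1 hZ a (zm_bound d1 d2 d3) c x hx).trans ?_
    have p1 : ((23:ℝ)/24)^k ≤ (47/48)^k := pow_le_pow_left₀ (by norm_num) (by norm_num) k
    have p2 : 0 ≤ Z * m := mul_nonneg hZ0 hm
    have p3 : (0:ℝ) ≤ (47/48)^k := by positivity
    rw [pow_succ]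
    nlinarith [mul_le_mul_of_nonneg_left p1 p2, mul_nonneg hb0 p3]

lemma solve {ε : ℝ} (h0 : 0 ≤ ε) (h1 : ε ≤ 1) (hZ : 9 * Z * ε ≤ 1 / 24) {q : ℝ → ℝ} {m : ℝ}
    (hq : ContDiffOn ℝ 1 q I) (hi : ∫ x in (0:ℝ)..1, q x = 0) (hN : N1 q m) :
    ∃ φ : ℝ → ℝ, ContDiffOn ℝ 1 φ I ∧ ∫ x in (0:ℝ)..1, φ x = 0 ∧
      (∀ x ∈ I, φ x - Le ε φ x = q x) ∧ N1 φ (24 * m) ∧ (ContDiffOn ℝ 2 q I → ContDiffOn ℝ 2 φ I) := by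
  have hP := iter_prop h0 h1 hZ hq hi hN
  set f : ℕ → ℝ → ℝ := fun k => (Le ε)^[k] q with hf
  have hgeo : HasSum (fun k : ℕ => ((23:ℝ)/24)^k * m) (24 * m) := by
    have := (hasSum_geometric_of_lt_one (r := (23:ℝ)/24) (by norm_num) (by norm_num)).mul_right m
    norm_num at this
    exact this
  have hb1 : ∀ k, ∀ x ∈ I, |f k x| ≤ (23/24)^k * m := fun k x hx =>
    (zm_bound (hP k).1 (hP k).2.1 (hP k).2.2 x hx).1
  have hb2 : ∀ k, ∀ x ∈ I, |dI (f k) x| ≤ 2 * ((23/24)^k * m) := fun k x hx =>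
    (zm_bound (hP k).1 (hP k).2.1 (hP k).2.2 x hx).2
  have hs : ∀ x ∈ I, Summable fun k => f k x := fun x hx =>
    Summable.of_norm_bounded hgeo.summable (fun k => hb1 k x hx)
  have hs' : ∀ x ∈ I, Summable fun k => dI (f k) x := fun x hx =>
    Summable.of_norm_bounded (hgeo.summable.mul_left 2) (fun k => hb2 k x hx)
  have hd := deriv_tsum (hgeo.summable.mul_left 2) (fun k => (C1_iff.1 (hP k).1).1)
    (fun k => (C1_iff.1 (hP k).1).2) hb2 hs
  have hdc : ContinuousOn (fun x => ∑' k, dI (f k) x) I :=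
    continuousOn_tsum (fun k => (C1_iff.1 (hP k).1).2) (hgeo.summable.mul_left 2)
      (fun k x hx => hb2 k x hx)
  obtain ⟨c1, c2⟩ := C1_of hd hdc
  refine ⟨fun x => ∑' k, f k x, c1, ?_, ?_, ?_, ?_⟩
  · have := int_tsum hgeo.summable (fun k => (hP k).1.continuousOn) hb1
    rw [← this.tsum_eq]
    have e : (fun n => ∫ x in (0:ℝ)..1, f n x) = fun _ => 0 := funext fun k => (hP k).2.1
    have e' : (∑' n, ∫ x in (0:ℝ)..1, (Le ε)^[n] q x) = ∑' n, ∫ x in (0:ℝ)..1, f n x := rfl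
    rw [e', e, tsum_zero]
  · intro x hx
    rw [Le_tsum ε hgeo.summable hb1 hx]
    change (∑' k, f k x) - _ = _
    rw [(hs x hx).tsum_eq_zero_add]
    have e : ∀ k, f (k+1) x = Le ε (f k) x := fun k => by
      simp only [hf, Function.iterate_succ_apply']
    simp_rw [e]
    simp [hf]
  · intro x hx
    rw [c2 hx]
    simp only
    rw [← tsum_mul_left, ← Summable.tsum_add (hs x hx) ((hs' x hx).mul_left _)]
    exact tsum_of_norm_bounded hgeo (fun k => (Real.norm_eq_abs _).le.trans ((hP k).2.2 x hx))
  · intro hq2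
    obtain ⟨B, hB⟩ := iter_N2 h0 h1 hZ hq2 hi hN
    have hgeo2 : Summable (fun k : ℕ => B * ((47:ℝ)/48)^k) :=
      (summable_geometric_of_lt_one (by norm_num) (by norm_num)).mul_left B
    have hb3 : ∀ k, ∀ x ∈ I, |dI (dI (f k)) x| ≤ B * (47/48)^k := by
      intro k x hx
      refine le_trans ?_ ((hB k).2 x hx)
      rw [abs_mul, abs_of_nonneg (by linarith [hx.1] : 0 ≤ 1 + x)]
      nlinarith [abs_nonneg (dI (dI (f k)) x), hx.1]
    have hfk := fun k => C1_iff.1 (C2_iff.1 (hB k).1).2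
    have hd2 := deriv_tsum hgeo2 (fun k => (hfk k).1) (fun k => (hfk k).2) hb3 hs'
    have hdc2 : ContinuousOn (fun x => ∑' k, dI (dI (f k)) x) I :=
      continuousOn_tsum (fun k => (hfk k).2) hgeo2 (fun k x hx => hb3 k x hx)
    exact C2_iff.2 ⟨c1, (C1_of hd2 hdc2).1.congr c2⟩

lemma Le_lin (ε : ℝ) {f g : ℝ → ℝ} (hf : ContinuousOn f I) (hg : ContinuousOn g I) {x : ℝ}
    (hx : x ∈ I) (a b : ℝ) :
    Le ε (fun t => a * f t + b * g t) x = a * Le ε f x + b * Le ε g x := by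
  unfold Le
  rw [LG_eq, LR_eq, S_sub brG le_rfl hf hg hx, S_sub brR le_rfl hf hg hx]
  ring

lemma exists_N1 {f : ℝ → ℝ} (hf : ContDiffOn ℝ 1 f I) : ∃ m, N1 f m :=
  bdd_of_cont (f := fun x => f x + (1 + x) * dI f x)
    (hf.continuousOn.add ((continuousOn_const.add continuousOn_id).mul (C1_iff.1 hf).2))

lemma int_comb {f g : ℝ → ℝ} (hf : ContinuousOn f I) (hg : ContinuousOn g I) (a b : ℝ) :
    ∫ x in (0:ℝ)..1, (a * f x + b * g x) =
      a * (∫ x in (0:ℝ)..1, f x) + b * ∫ x in (0:ℝ)..1, g x := by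
  rw [intervalIntegral.integral_add ((intble hf).const_mul _) ((intble hg).const_mul _),
    intervalIntegral.integral_const_mul, intervalIntegral.integral_const_mul]

/-- uniqueness of solutions of f - Lf = q with prescribed mean -/
lemma uniq {ε : ℝ} (h0 : 0 ≤ ε) (h1 : ε ≤ 1) (hZ : 9 * Z * ε ≤ 1 / 24) {f g : ℝ → ℝ}
    (hf : ContDiffOn ℝ 1 f I) (hg : ContDiffOn ℝ 1 g I)
    (hi : ∫ x in (0:ℝ)..1, f x = ∫ x in (0:ℝ)..1, g x)
    (he : ∀ x ∈ I, f x - Le ε f x = g x - Le ε g x) : Set.EqOn f g I := by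
  set d : ℝ → ℝ := fun x => 1 * f x + (-1) * g x with hd
  have hd1 : ContDiffOn ℝ 1 d I := (comb_C1 hf hg 1 (-1)).1
  have hdi : ∫ x in (0:ℝ)..1, d x = 0 := by
    rw [hd, int_comb hf.continuousOn hg.continuousOn, hi]; ring
  have hfix : Set.EqOn (Le ε d) d I := by
    intro x hx
    have := he x hx
    rw [hd, Le_lin ε hf.continuousOn hg.continuousOn hx]
    simp only
    linarith
  obtain ⟨m, hm⟩ := exists_N1 hd1
  have hit : ∀ k : ℕ, N1 d ((23/24)^k * m) := by
    intro k
    induction k with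
    | zero => simpa using hm
    | succ k ih =>
      intro x hx
      have := Le_N1 h0 h1 hZ hd1 hdi ih x hx
      rw [hfix hx, show dI (Le ε d) x = dI d x from derivWithin_congr hfix (hfix hx)] at this
      exact this.trans (le_of_eq (by ring))
  intro x hx
  have hb : ∀ k : ℕ, |d x| ≤ (23/24)^k * m := fun k => (zm_bound hd1 hdi (hit k) x hx).1
  have hl : Tendsto (fun k : ℕ => ((23:ℝ)/24)^k * m) atTop (𝓝 (0 * m)) :=
    (tendsto_pow_atTop_nhds_zero_of_lt_one (by norm_num) (by norm_num)).mul_const m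
  have h2 : |d x| ≤ 0 := by
    have := ge_of_tendsto' hl hb
    simpa using this
  have h3 : d x = 0 := abs_nonpos_iff.1 h2
  simp only [hd] at h3
  linarith

open Filter Topology
lemma C1n_le {f : ℝ → ℝ} {a b : ℝ} (ha : ∀ x ∈ I, |f x| ≤ a) (hb : ∀ x ∈ I, |dI f x| ≤ b) :
    C1n f ≤ a + b := by
  have : Nonempty (Set.Icc (0:ℝ) 1) := ⟨⟨0, le_rfl, by norm_num⟩⟩
  exact add_le_add (ciSup_le fun x => ha x x.2) (ciSup_le fun x => hb x x.2)

lemma C1n_nonneg (f : ℝ → ℝ) : 0 ≤ C1n f :=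
  add_nonneg (Real.iSup_nonneg fun _ => abs_nonneg _) (Real.iSup_nonneg fun _ => abs_nonneg _)

lemma N1_C1n {f : ℝ → ℝ} (hf : ContDiffOn ℝ 1 f I) : N1 f (2 * C1n f) := by
  obtain ⟨a, ha⟩ := bdd_of_cont hf.continuousOn
  obtain ⟨b, hb⟩ := bdd_of_cont (C1_iff.1 hf).2
  intro x hx
  have h1 : |f x| ≤ ⨆ x : Set.Icc (0:ℝ) 1, |f x| :=
    le_ciSup (f := fun x : Set.Icc (0:ℝ) 1 => |f x|)
      ⟨a, by rintro _ ⟨y, rfl⟩; exact ha y y.2⟩ ⟨x, hx⟩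
  have h2 : |dI f x| ≤ ⨆ x : Set.Icc (0:ℝ) 1, |derivWithin f (Set.Icc 0 1) x| :=
    le_ciSup (f := fun x : Set.Icc (0:ℝ) 1 => |derivWithin f (Set.Icc 0 1) x|)
      ⟨b, by rintro _ ⟨y, rfl⟩; exact hb y y.2⟩ ⟨x, hx⟩
  refine (abs_add_le _ _).trans ?_
  rw [abs_mul, abs_of_nonneg (by linarith [hx.1] : 0 ≤ 1 + x)]
  unfold C1n
  nlinarith [abs_nonneg (f x), abs_nonneg (dI f x), hx.2]

lemma C1n_zm {f : ℝ → ℝ} {m : ℝ} (hf : ContDiffOn ℝ 1 f I) (hi : ∫ x in (0:ℝ)..1, f x = 0)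
    (hN : N1 f m) : C1n f ≤ 3 * m := by
  have h := zm_bound hf hi hN
  have := C1n_le (fun x hx => (h x hx).1) (fun x hx => (h x hx).2)
  linarith

lemma log2_pos : 0 < Real.log 2 := Real.log_pos (by norm_num)

lemma hG_C2 : ContDiffOn ℝ 2 hG I := by
  unfold hG
  refine contDiffOn_const.mul (contDiffOn_const.div (contDiffOn_const.add contDiffOn_id) ?_)
  intro x hx
  have := hx.1
  positivity

lemma hG_lower {x : ℝ} (hx : x ∈ I) : 1 / 2 ≤ hG x := by
  unfold hG
  have h1 : Real.log 2 ≤ 1 := by linarith [Real.log_two_lt_d9]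
  have h2 : 1 ≤ 1 / Real.log 2 := by rw [le_div_iff₀ log2_pos]; linarith
  have h3 : 1 / 2 ≤ 1 / (1 + x) := by
    apply one_div_le_one_div_of_le <;> linarith [hx.1, hx.2]
  nlinarith

lemma int_hG : ∫ x in (0:ℝ)..1, hG x = 1 := by
  unfold hG
  rw [intervalIntegral.integral_const_mul]
  have : ∫ x in (0:ℝ)..1, 1 / (1 + x) = Real.log 2 := by
    rw [intervalIntegral.integral_comp_add_left (fun x => 1 / x) 1, integral_one_div]
    · norm_num
    · rw [Set.uIcc_of_le (by norm_num)]
      intro h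
      linarith [h.1]
  rw [this]
  field_simp [log2_pos.ne']

lemma LG_hG {x : ℝ} (hx : x ∈ I) : LG hG x = hG x := by
  obtain ⟨m, hm⟩ := bdd_of_cont hG_C2.continuousOn
  have hs := S_summable brG (k := 2) le_rfl hm hx
  set a : ℕ → ℝ := fun n => (1 / Real.log 2) * (1 / ((n:ℝ) + 1 + x)) with ha
  have e : ∀ n : ℕ, hG (0 + 1 / ((n:ℝ) + 1 + x)) / ((n:ℝ) + 1 + x) ^ 2 = a n - a (n+1) := by
    intro n
    have h1 := one_le_m hx n
    have h2 : (n:ℝ) + 1 + x ≠ 0 := by linarith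
    have h3 : (n:ℝ) + 2 + x ≠ 0 := by linarith
    have hl := log2_pos.ne'
    have e3 : 1 + (0 + 1 / ((n:ℝ) + 1 + x)) = ((n:ℝ) + 2 + x) / ((n:ℝ) + 1 + x) := by
      field_simp; ring
    simp only [ha, hG, e3]
    push_cast
    rw [show (n:ℝ) + 1 + 1 + x = n + 2 + x by ring]
    field_simp
    ring
  simp_rw [e] at hs
  have hl : Tendsto a atTop (𝓝 ((1 / Real.log 2) * 0)) := (tendsto_inv_m x).const_mul _
  rw [LG_eq]
  unfold S
  simp_rw [e]
  rw [tele hs hl]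
  simp [ha, hG]

/-- the perturbation -/
noncomputable def rr (x : ℝ) : ℝ := LR hG x - hG x

lemma rr_C2 : ContDiffOn ℝ 2 rr I := (LR_C2 hG_C2).1.sub hG_C2

lemma rr_int : ∫ x in (0:ℝ)..1, rr x = 0 := by
  unfold rr
  rw [intervalIntegral.integral_sub (intble (LR_cont hG_C2.continuousOn))
    (intble hG_C2.continuousOn), int_LR hG_C2.continuousOn, sub_self]

lemma Le_zero (f : ℝ → ℝ) : Le 0 f = LG f := by
  funext x; simp [Le]

theorem main :
    ∃ ε₀ > (0:ℝ), ∃ h : ℝ → ℝ → ℝ, ∃ hstar : ℝ → ℝ,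
      (∀ ε ∈ Set.Ioc (0:ℝ) ε₀,
        (ContDiffOn ℝ 2 (h ε) (Set.Icc 0 1) ∧ (∀ x ∈ Set.Icc (0:ℝ) 1, 0 ≤ h ε x) ∧
          (∫ x in (0:ℝ)..1, h ε x) = 1 ∧
          ∀ x ∈ Set.Icc (0:ℝ) 1, (1 - ε) * LG (h ε) x + ε * LR (h ε) x = h ε x) ∧
        ∀ h' : ℝ → ℝ,
          (ContDiffOn ℝ 2 h' (Set.Icc 0 1) ∧ (∀ x ∈ Set.Icc (0:ℝ) 1, 0 ≤ h' x) ∧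
            (∫ x in (0:ℝ)..1, h' x) = 1 ∧
            ∀ x ∈ Set.Icc (0:ℝ) 1, (1 - ε) * LG h' x + ε * LR h' x = h' x) →
          Set.EqOn h' (h ε) (Set.Icc 0 1)) ∧
      (∃ C > (0:ℝ), ∀ q : ℝ → ℝ, ContDiffOn ℝ 1 q (Set.Icc 0 1) →
        (∫ x in (0:ℝ)..1, q x) = 0 →
        ∃ φ : ℝ → ℝ,
          (ContDiffOn ℝ 1 φ (Set.Icc 0 1) ∧ (∫ x in (0:ℝ)..1, φ x) = 0 ∧
            (∀ x ∈ Set.Icc (0:ℝ) 1, φ x - LG φ x = q x) ∧ C1n φ ≤ C * C1n q) ∧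
          ∀ φ' : ℝ → ℝ, ContDiffOn ℝ 1 φ' (Set.Icc 0 1) → (∫ x in (0:ℝ)..1, φ' x) = 0 →
            (∀ x ∈ Set.Icc (0:ℝ) 1, φ' x - LG φ' x = q x) →
            Set.EqOn φ' φ (Set.Icc 0 1)) ∧
      (∫ x in (0:ℝ)..1, (LR hG x - hG x)) = 0 ∧
      (ContDiffOn ℝ 1 hstar (Set.Icc 0 1) ∧ (∫ x in (0:ℝ)..1, hstar x) = 0 ∧
        ∀ x ∈ Set.Icc (0:ℝ) 1, hstar x - LG hstar x = LR hG x - hG x) ∧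
      Filter.Tendsto (fun ε => C1n (fun x => (h ε x - hG x) / ε - hstar x))
        (nhdsWithin 0 (Set.Ioi 0)) (nhds 0) := by
  have hZ0 := Z_nonneg
  have z0 : 9 * Z * (0:ℝ) ≤ 1 / 24 := by norm_num
  have hrr1 : ContDiffOn ℝ 1 rr I := (C2_iff.1 rr_C2).1
  have hGc : ContinuousOn hG I := hG_C2.continuousOn
  obtain ⟨m, hm⟩ := exists_N1 hrr1
  have hm0 : 0 ≤ m := (abs_nonneg _).trans (hm 0 ⟨le_rfl, by norm_num⟩)
  set ε₀ : ℝ := 1 / (216 * Z + 48 * m + 1) with hε₀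
  have hε₀pos : 0 < ε₀ := by positivity
  have small : ∀ ε ∈ Set.Ioc (0:ℝ) ε₀, ε ≤ 1 ∧ 9 * Z * ε ≤ 1 / 24 ∧ ε * (24 * m) ≤ 1 / 2 := by
    rintro ε ⟨h0, h1⟩
    rw [hε₀, le_div_iff₀ (by positivity)] at h1
    have a1 := mul_nonneg h0.le hZ0
    have a2 := mul_nonneg h0.le hm0
    refine ⟨?_, ?_, ?_⟩ <;> nlinarith
  have hW : ∀ ε, ∃ W : ℝ → ℝ, ε ∈ Set.Ioc (0:ℝ) ε₀ → (ContDiffOn ℝ 1 W I ∧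
      ∫ x in (0:ℝ)..1, W x = 0 ∧ (∀ x ∈ I, W x - Le ε W x = rr x) ∧ N1 W (24 * m) ∧
      ContDiffOn ℝ 2 W I) := by
    intro ε
    by_cases hε : ε ∈ Set.Ioc (0:ℝ) ε₀
    · obtain ⟨W, w1, w2, w3, w4, w5⟩ := solve hε.1.le (small ε hε).1 (small ε hε).2.1
        hrr1 rr_int hm
      exact ⟨W, fun _ => ⟨w1, w2, w3, w4, w5 rr_C2⟩⟩
    · exact ⟨0, fun h => absurd h hε⟩
  choose W hW using hW
  obtain ⟨hs, s1, s2, s3, -, -⟩ := solve le_rfl zero_le_one z0 hrr1 rr_int hm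
  refine ⟨ε₀, hε₀pos, fun ε x => 1 * hG x + ε * W ε x, hs, ?_, ?_, rr_int, ⟨s1, s2, ?_⟩, ?_⟩
  · intro ε hε
    obtain ⟨w1, w2, w3, w4, w5⟩ := hW ε hε
    obtain ⟨e1, e2, e3⟩ := small ε hε
    have hC2 : ContDiffOn ℝ 2 (fun x => 1 * hG x + ε * W ε x) I :=
      (contDiffOn_const.mul hG_C2).add (contDiffOn_const.mul w5)
    have hintg : ∫ x in (0:ℝ)..1, (1 * hG x + ε * W ε x) = 1 := by
      rw [int_comb hGc w1.continuousOn, int_hG, w2]; ring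
    have hfix : ∀ x ∈ I, Le ε (fun x => 1 * hG x + ε * W ε x) x = 1 * hG x + ε * W ε x := by
      intro x hx
      rw [Le_lin ε hGc w1.continuousOn hx]
      have h1 : Le ε hG x = hG x + ε * rr x := by
        unfold Le rr; rw [LG_hG hx]; ring
      have h2 := w3 x hx
      rw [h1]
      linear_combination (-ε) * h2
    refine ⟨⟨hC2, ?_, hintg, hfix⟩, ?_⟩
    · intro x hx
      have b1 := hG_lower hx
      have b2 := abs_le.1 (zm_bound w1 w2 w4 x hx).1
      have := mul_le_mul_of_nonneg_left b2.1 hε.1.le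
      simp only
      linarith
    · rintro h' ⟨k1, k2, k3, k4⟩
      refine uniq hε.1.le e1 e2 (C2_iff.1 k1).1 (C2_iff.1 hC2).1 (k3.trans hintg.symm) ?_
      intro x hx
      have : Le ε h' x = h' x := k4 x hx
      rw [hfix x hx, this]; ring
  · refine ⟨144, by norm_num, fun q hq hi => ?_⟩
    obtain ⟨φ, p1, p2, p3, p4, -⟩ := solve le_rfl zero_le_one z0 hq hi (N1_C1n hq)
    refine ⟨φ, ⟨p1, p2, ?_, ?_⟩, ?_⟩
    · intro x hx
      have := p3 x hx
      rwa [Le_zero] at this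
    · have := C1n_zm p1 p2 p4
      linarith
    · intro φ' k1 k2 k3
      refine uniq le_rfl zero_le_one z0 k1 p1 (k2.trans p2.symm) ?_
      intro x hx
      rw [p3 x hx, Le_zero]
      exact k3 x hx
  · intro x hx
    have := s3 x hx
    rwa [Le_zero] at this
  · set K : ℝ := 24 * ((9 * Z + 1) * (24 * m)) * 3 with hK
    have hbound : ∀ ε ∈ Set.Ioc (0:ℝ) ε₀,
        C1n (fun x => (1 * hG x + ε * W ε x - hG x) / ε - hs x) ≤ K * ε := by
      intro ε hε
      obtain ⟨w1, w2, w3, w4, w5⟩ := hW ε hε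
      have e : (fun x => (1 * hG x + ε * W ε x - hG x) / ε - hs x) =
          fun x => 1 * W ε x + (-1) * hs x := by
        funext x
        have := hε.1.ne'
        field_simp
        ring
      rw [e]
      set v : ℝ → ℝ := fun x => 1 * W ε x + (-1) * hs x with hv
      have v1 : ContDiffOn ℝ 1 v I := (comb_C1 w1 s1 1 (-1)).1
      have v2 : ∫ x in (0:ℝ)..1, v x = 0 := by
        rw [hv, int_comb w1.continuousOn s1.continuousOn, w2, s2]; ring
      set g : ℝ → ℝ := fun x => ε * LR (W ε) x + (-ε) * LG (W ε) x with hg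
      have g1 : ContDiffOn ℝ 1 g I := (comb_C1 (LR_C1 w1).1 (LG_C1 w1).1 ε (-ε)).1
      have g2 : ∫ x in (0:ℝ)..1, g x = 0 := by
        rw [hg, int_comb (LR_cont w1.continuousOn) (LG_cont w1.continuousOn),
          int_LR w1.continuousOn, int_LG w1.continuousOn, w2]; ring
      have g3 := comb_N1 (LR_C1 w1).1 (LG_C1 w1).1 ε (-ε)
        (LR_N1 w1 (zm_bound w1 w2 w4)) (contraction w1 w4)
      obtain ⟨φ, p1, p2, p3, p4, -⟩ := solve le_rfl zero_le_one z0 g1 g2 g3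
      have hvφ : Set.EqOn v φ I := by
        refine uniq le_rfl zero_le_one z0 v1 p1 (v2.trans p2.symm) ?_
        intro x hx
        rw [p3 x hx, hv, Le_lin 0 w1.continuousOn s1.continuousOn hx]
        have a1 := w3 x hx
        have a2 := s3 x hx
        rw [Le_zero] at a2 ⊢
        rw [Le_zero]
        unfold Le at a1
        simp only [hg]
        linarith
      have hN : N1 v (24 * (|ε| * (9 * Z * (24 * m)) + |-ε| * (11 / 12 * (24 * m)))) := by
        intro x hx
        rw [hvφ hx, show dI v x = dI φ x from derivWithin_congr hvφ (hvφ hx)]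
        exact p4 x hx
      refine (C1n_zm v1 v2 hN).trans ?_
      rw [abs_neg, abs_of_pos hε.1, hK]
      nlinarith [mul_nonneg hε.1.le hm0]
    have hlim : Tendsto (fun ε : ℝ => K * ε) (𝓝[>] 0) (𝓝 0) := by
      have : Tendsto (fun ε : ℝ => K * ε) (𝓝 0) (𝓝 (K * 0)) := tendsto_id.const_mul K
      rw [mul_zero] at this
      exact this.mono_left nhdsWithin_le_nhds
    refine squeeze_zero' (Eventually.of_forall fun ε => C1n_nonneg _) ?_ hlim
    filter_upwards [Ioc_mem_nhdsGT hε₀pos] with ε hε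
    exact hbound ε hε

end GR

/-- linear response for the random Gauss–Rényi system.  For small ε > 0 the
operator L_ε = (1−ε)L_G + εL_R has a unique fixed probability density h_ε ∈ C²([0,1]);
I − L_G is boundedly invertible on zero-mean C¹ functions; L_R h_G − h_G has zero mean;
and ‖h_ε − h_G − ε(I−L_G)^{-1}(L_R h_G − h_G)‖_{C¹} = o(ε) as ε → 0⁺. -/
theorem stmt16 :
    ∃ ε₀ > (0:ℝ), ∃ h : ℝ → ℝ → ℝ, ∃ hstar : ℝ → ℝ,
      (∀ ε ∈ Set.Ioc (0:ℝ) ε₀,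
        (ContDiffOn ℝ 2 (h ε) (Set.Icc 0 1) ∧ (∀ x ∈ Set.Icc (0:ℝ) 1, 0 ≤ h ε x) ∧
          (∫ x in (0:ℝ)..1, h ε x) = 1 ∧
          ∀ x ∈ Set.Icc (0:ℝ) 1, (1 - ε) * LG (h ε) x + ε * LR (h ε) x = h ε x) ∧
        ∀ h' : ℝ → ℝ,
          (ContDiffOn ℝ 2 h' (Set.Icc 0 1) ∧ (∀ x ∈ Set.Icc (0:ℝ) 1, 0 ≤ h' x) ∧
            (∫ x in (0:ℝ)..1, h' x) = 1 ∧
            ∀ x ∈ Set.Icc (0:ℝ) 1, (1 - ε) * LG h' x + ε * LR h' x = h' x) →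
          Set.EqOn h' (h ε) (Set.Icc 0 1)) ∧
      (∃ C > (0:ℝ), ∀ q : ℝ → ℝ, ContDiffOn ℝ 1 q (Set.Icc 0 1) →
        (∫ x in (0:ℝ)..1, q x) = 0 →
        ∃ φ : ℝ → ℝ,
          (ContDiffOn ℝ 1 φ (Set.Icc 0 1) ∧ (∫ x in (0:ℝ)..1, φ x) = 0 ∧
            (∀ x ∈ Set.Icc (0:ℝ) 1, φ x - LG φ x = q x) ∧ C1n φ ≤ C * C1n q) ∧
          ∀ φ' : ℝ → ℝ, ContDiffOn ℝ 1 φ' (Set.Icc 0 1) → (∫ x in (0:ℝ)..1, φ' x) = 0 →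
            (∀ x ∈ Set.Icc (0:ℝ) 1, φ' x - LG φ' x = q x) →
            Set.EqOn φ' φ (Set.Icc 0 1)) ∧
      (∫ x in (0:ℝ)..1, (LR hG x - hG x)) = 0 ∧
      (ContDiffOn ℝ 1 hstar (Set.Icc 0 1) ∧ (∫ x in (0:ℝ)..1, hstar x) = 0 ∧
        ∀ x ∈ Set.Icc (0:ℝ) 1, hstar x - LG hstar x = LR hG x - hG x) ∧
      Filter.Tendsto (fun ε => C1n (fun x => (h ε x - hG x) / ε - hstar x))
        (nhdsWithin 0 (Set.Ioi 0)) (nhds 0) := by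
  exact GR.main
end

section
/- For every u ∈ [α₀, α₁] and every ε with |ε| ≤ α₀/4, the density ρ_ε is positive and satisfies |∂_ε ρ_ε(u)| ≤ C · ρ_ε(u) with the constant C = 8(α₁ − α₀)/α₀², independent of ε; explicitly, ∂_ε ρ_ε(u)/ρ_ε(u) = 2(α₁ + α₀ − 2u)/((α₁ + 2ε)(2u − α₀ + 2ε)). -/
/-- for the family of densities ρ_ε(u) = 2/((α₁−α₀)(α₁+2ε))·(u − α₀/2 + ε)
on [α₀,α₁], for |ε| ≤ α₀/4 and u ∈ [α₀,α₁], ρ_ε(u) > 0,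
|∂_ε ρ_ε(u)| ≤ (8(α₁−α₀)/α₀²)·ρ_ε(u), and explicitly
∂_ε ρ_ε(u)/ρ_ε(u) = 2(α₁+α₀−2u)/((α₁+2ε)(2u−α₀+2ε)). -/
theorem stmt18 (α₀ α₁ : ℝ) (h0 : 0 < α₀) (h01 : α₀ < α₁) (h1 : α₁ < 1)
    (ρ : ℝ → ℝ → ℝ)
    (hρ : ∀ ε u, ρ ε u = 2 / ((α₁ - α₀) * (α₁ + 2 * ε)) * (u - α₀ / 2 + ε))
    (ε u : ℝ) (hε : |ε| ≤ α₀ / 4) (hu : u ∈ Set.Icc α₀ α₁) :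
    0 < ρ ε u ∧
    |deriv (fun e => ρ e u) ε| ≤ (8 * (α₁ - α₀) / α₀ ^ 2) * ρ ε u ∧
    deriv (fun e => ρ e u) ε / ρ ε u
      = 2 * (α₁ + α₀ - 2 * u) / ((α₁ + 2 * ε) * (2 * u - α₀ + 2 * ε)) := by
  obtain ⟨hu0, hu1⟩ := hu
  obtain ⟨he0, he1⟩ := abs_le.mp hε
  have hA : α₀ / 2 ≤ α₁ + 2 * ε := by linarith
  have hB : α₀ / 2 ≤ 2 * u - α₀ + 2 * ε := by linarith
  have hA0 : 0 < α₁ + 2 * ε := by linarith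
  have hB0 : 0 < 2 * u - α₀ + 2 * ε := by linarith
  have hD : 0 < α₁ - α₀ := by linarith
  have hpos : 0 < ρ ε u := by
    rw [hρ]
    have : 0 < u - α₀ / 2 + ε := by linarith
    positivity
  have hder : deriv (fun e => ρ e u) ε
      = 2 * (α₁ + α₀ - 2 * u) / ((α₁ + 2 * ε) * (2 * u - α₀ + 2 * ε)) * ρ ε u := by
    have hf : (fun e => ρ e u)
        = fun e => (2 * (u - α₀ / 2 + e)) / ((α₁ - α₀) * (α₁ + 2 * e)) := by
      funext e
      rw [hρ]
      ring
    have hn : HasDerivAt (fun e : ℝ => 2 * (u - α₀ / 2 + e)) (2 * 1) ε :=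
      ((hasDerivAt_id ε).const_add (u - α₀ / 2)).const_mul 2
    have hd : HasDerivAt (fun e : ℝ => (α₁ - α₀) * (α₁ + 2 * e)) ((α₁ - α₀) * (2 * 1)) ε :=
      (((hasDerivAt_id ε).const_mul 2).const_add α₁).const_mul (α₁ - α₀)
    have hq := (hn.div hd (by positivity)).deriv
    rw [hf]
    refine hq.trans ?_
    rw [hρ]
    have e1 : u - α₀ / 2 + ε = (2 * u - α₀ + 2 * ε) / 2 := by ring
    rw [e1]
    have hA1 := hA0.ne'
    have hB1 := hB0.ne'
    have hD1 := hD.ne'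
    field_simp
    ring
  refine ⟨hpos, ?_, ?_⟩
  · rw [hder, abs_mul, abs_of_pos hpos]
    refine mul_le_mul_of_nonneg_right ?_ hpos.le
    have hP : α₀ ^ 2 / 4 ≤ (α₁ + 2 * ε) * (2 * u - α₀ + 2 * ε) := by
      have := mul_le_mul hA hB (by positivity) hA0.le
      linarith
    have hN : |2 * (α₁ + α₀ - 2 * u)| ≤ 2 * (α₁ - α₀) := by
      rw [abs_le]
      constructor <;> linarith
    rw [abs_div, abs_of_pos (mul_pos hA0 hB0)]
    calc _ ≤ 2 * (α₁ - α₀) / (α₀ ^ 2 / 4) :=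
          div_le_div₀ (by positivity) hN (by positivity) hP
      _ = _ := by
          field_simp
          ring
  · rw [hder, mul_div_assoc, div_self hpos.ne', mul_one]
end

section
/- For every c ≥ 1 and every fixed ε with |ε| ≤ α₀/4, the asymptotic E_{η_ε}[e^{−(cu−α₀)t}] ∼ c̃(η_ε) · (1/(ct)) · e^{−(c−1)α₀ t} holds as t → ∞, where c̃(η_ε) = (α₀ + 2ε)/((α₁ − α₀)(α₁ + 2ε)); equivalently, lim_{t→∞} c t · e^{(c−1)α₀ t} · ∫_{α₀}^{α₁} e^{−(cu−α₀)t} ρ_ε(u) du = (α₀ + 2ε)/((α₁ − α₀)(α₁ + 2ε)). -/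
/-- for c ≥ 1 and |ε| ≤ α₀/4,
E_{η_ε}[e^{−(cu−α₀)t}] ∼ c̃(η_ε)·(1/(ct))·e^{−(c−1)α₀t} as t → ∞, i.e.
lim_{t→∞} ct·e^{(c−1)α₀t}·∫_{α₀}^{α₁} e^{−(cu−α₀)t} ρ_ε(u) du
  = (α₀+2ε)/((α₁−α₀)(α₁+2ε)). -/
theorem stmt19 (α₀ α₁ : ℝ) (h0 : 0 < α₀) (h01 : α₀ < α₁) (h1 : α₁ < 1)
    (ρ : ℝ → ℝ → ℝ)
    (hρ : ∀ ε u, ρ ε u = 2 / ((α₁ - α₀) * (α₁ + 2 * ε)) * (u - α₀ / 2 + ε))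
    (ε : ℝ) (hε : |ε| ≤ α₀ / 4) (c : ℝ) (hc : 1 ≤ c) :
    Filter.Tendsto
      (fun t : ℝ => c * t * Real.exp ((c - 1) * α₀ * t) *
        ∫ u in α₀..α₁, Real.exp (-(c * u - α₀) * t) * ρ ε u)
      Filter.atTop
      (nhds ((α₀ + 2 * ε) / ((α₁ - α₀) * (α₁ + 2 * ε)))) := by
  set K : ℝ := 2 / ((α₁ - α₀) * (α₁ + 2 * ε)) with hK
  have hc0 : 0 < c := by linarith
  have hint : ∀ t : ℝ, 0 < t →
      (∫ u in α₀..α₁, Real.exp (-(c * u - α₀) * t) * ρ ε u) =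
        (-K * Real.exp (-(c * α₁ - α₀) * t) *
            ((α₁ - α₀ / 2 + ε) / (c * t) + 1 / (c * t) ^ 2)) -
        (-K * Real.exp (-(c * α₀ - α₀) * t) *
            ((α₀ - α₀ / 2 + ε) / (c * t) + 1 / (c * t) ^ 2)) := by
    intro t ht
    have hct : c * t ≠ 0 := by positivity
    apply intervalIntegral.integral_eq_sub_of_hasDerivAt
      (f := fun u => -K * Real.exp (-(c * u - α₀) * t) *
            ((u - α₀ / 2 + ε) / (c * t) + 1 / (c * t) ^ 2))
    · intro u _
      have e1 : HasDerivAt (fun u : ℝ => -(c * u - α₀) * t) (-(c * 1) * t) u :=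
        ((((hasDerivAt_id u).const_mul c).sub_const α₀).neg).mul_const t
      have e2 : HasDerivAt (fun u : ℝ => (u - α₀ / 2 + ε) / (c * t) + 1 / (c * t) ^ 2)
          (1 / (c * t)) u :=
        ((((hasDerivAt_id u).sub_const (α₀ / 2)).add_const ε).div_const (c * t)).add_const _
      refine ((e1.exp.const_mul (-K)).mul e2).congr_deriv ?_
      rw [hρ, ← hK]
      field_simp
      ring
    · apply Continuous.intervalIntegrable
      simp only [hρ]
      fun_prop
  have hct : Filter.Tendsto (fun t : ℝ => c * t) Filter.atTop Filter.atTop :=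
    Filter.tendsto_id.const_mul_atTop hc0
  have hinv : Filter.Tendsto (fun t : ℝ => (c * t)⁻¹) Filter.atTop (nhds 0) :=
    tendsto_inv_atTop_zero.comp hct
  have hexp : Filter.Tendsto (fun t : ℝ => Real.exp (-((α₁ - α₀) * (c * t))))
      Filter.atTop (nhds 0) :=
    Real.tendsto_exp_neg_atTop_nhds_zero.comp (hct.const_mul_atTop (sub_pos.2 h01))
  have hlim : Filter.Tendsto (fun t : ℝ =>
      K * ((α₀ - α₀ / 2 + ε) + (c * t)⁻¹) -
      K * (Real.exp (-((α₁ - α₀) * (c * t))) * ((α₁ - α₀ / 2 + ε) + (c * t)⁻¹)))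
      Filter.atTop (nhds (K * ((α₀ - α₀ / 2 + ε) + 0) -
        K * (0 * ((α₁ - α₀ / 2 + ε) + 0)))) :=
    ((hinv.const_add _).const_mul K).sub ((hexp.mul (hinv.const_add _)).const_mul K)
  have hval : K * ((α₀ - α₀ / 2 + ε) + 0) - K * (0 * ((α₁ - α₀ / 2 + ε) + 0)) =
      (α₀ + 2 * ε) / ((α₁ - α₀) * (α₁ + 2 * ε)) := by
    rw [hK]; ring
  rw [hval] at hlim
  refine hlim.congr' ?_
  filter_upwards [Filter.eventually_gt_atTop 0] with t ht
  rw [hint t ht]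
  have ha : Real.exp (-(c * α₁ - α₀) * t) =
      Real.exp (-((α₁ - α₀) * (c * t))) * Real.exp (-((c - 1) * α₀ * t)) := by
    rw [← Real.exp_add]; congr 1; ring
  have hb : Real.exp (-(c * α₀ - α₀) * t) = Real.exp (-((c - 1) * α₀ * t)) := by
    congr 1; ring
  rw [ha, hb, Real.exp_neg ((c - 1) * α₀ * t)]
  have hE := Real.exp_ne_zero ((c - 1) * α₀ * t)
  generalize Real.exp ((c - 1) * α₀ * t) = E at hE ⊢
  generalize Real.exp (-((α₁ - α₀) * (c * t))) = G
  clear_value K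
  field_simp
  ring
end
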